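/- arXiv:2403.03887 — 2 statements merged into one kernel-verified Lean document; each statement's English description precedes it below -/
import Mathlib

section
/- There exists an involution θ in Homeo(S¹ × ℝ) (i.e., θ² = identity) such that every element of the commutator subgroup of Homeo(S¹ × ℝ) can be expressed as a product of at most 17 conjugates of θ in Homeo(S¹ × ℝ). -/
open Pointwise

instance instGroupHomeomorph (X : Type*) [TopologicalSpace X] : Group (X ≃ₜ X) where
  mul f g := g.trans f
  one := Homeomorph.refl X
  inv := Homeomorph.symm
  mul_assoc _ _ _ := Homeomorph.ext fun _ => rfl
  one_mul _ := Homeomorph.ext fun _ => rfl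
  mul_one _ := Homeomorph.ext fun _ => rfl
  inv_mul_cancel f := Homeomorph.ext fun x => f.symm_apply_apply x

open Set Filter Topology

/-- The eventual value of `a⁻ⁿ bⁿ x`, where `n` is chosen such that `bⁿ x` lies in `U`. -/
noncomputable def wanderingMap {X : Type*} [TopologicalSpace X] (a b : X ≃ₜ X) {U : Set X}
    (hb : ∀ x, ∃ n : ℕ, b^[n] x ∈ U) (x : X) : X :=
  a.symm^[(hb x).choose] (b^[(hb x).choose] x)

section Wandering

variable {X : Type*} [TopologicalSpace X] {a b : X ≃ₜ X} {U : Set X}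

theorem iterate_mem_of_le (hbU : ∀ x ∈ U, b x ∈ U) {x : X} {n m : ℕ} (hnm : n ≤ m)
    (hn : b^[n] x ∈ U) : b^[m] x ∈ U := by
  induction m, hnm using Nat.le_induction with
  | base => exact hn
  | succ k _ ih => rw [Function.iterate_succ_apply']; exact hbU _ ih

theorem symm_iterate_eq_of_le (hbU : ∀ x ∈ U, b x ∈ U) (hab : ∀ x ∈ U, a x = b x) {x : X}
    {n m : ℕ} (hnm : n ≤ m) (hn : b^[n] x ∈ U) :
    a.symm^[m] (b^[m] x) = a.symm^[n] (b^[n] x) := by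
  induction m, hnm using Nat.le_induction with
  | base => rfl
  | succ k hk ih =>
    rw [Function.iterate_succ_apply' b, Function.iterate_succ_apply,
      ← hab _ (iterate_mem_of_le hbU hk hn), a.symm_apply_apply, ih]

theorem wanderingMap_eq (hbU : ∀ x ∈ U, b x ∈ U) (hab : ∀ x ∈ U, a x = b x)
    (hb : ∀ x, ∃ n : ℕ, b^[n] x ∈ U) {x : X} {n : ℕ} (hn : b^[n] x ∈ U) :
    wanderingMap a b hb x = a.symm^[n] (b^[n] x) := by
  rcases le_total n (hb x).choose with h | h
  · exact symm_iterate_eq_of_le hbU hab h hn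
  · exact (symm_iterate_eq_of_le hbU hab h (hb x).choose_spec).symm

theorem continuous_wanderingMap (hU : IsOpen U) (hbU : ∀ x ∈ U, b x ∈ U)
    (hab : ∀ x ∈ U, a x = b x) (hb : ∀ x, ∃ n : ℕ, b^[n] x ∈ U) :
    Continuous (wanderingMap a b hb) := by
  refine continuous_iff_continuousAt.2 fun x => ?_
  obtain ⟨n, hn⟩ := hb x
  have hc : Continuous fun y => a.symm^[n] (b^[n] y) :=
    (a.symm.continuous.iterate n).comp (b.continuous.iterate n)
  refine hc.continuousAt.congr ?_
  filter_upwards [(b.continuous.iterate n).continuousAt.preimage_mem_nhds (hU.mem_nhds hn)]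
    with y hy
  exact (wanderingMap_eq hbU hab hb hy).symm

theorem wanderingMap_wanderingMap (hbU : ∀ x ∈ U, b x ∈ U) (hab : ∀ x ∈ U, a x = b x)
    (hb : ∀ x, ∃ n : ℕ, b^[n] x ∈ U) (ha : ∀ x, ∃ n : ℕ, a^[n] x ∈ U) (x : X) :
    wanderingMap b a ha (wanderingMap a b hb x) = x := by
  obtain ⟨n, hn⟩ := hb x
  have h1 : a^[n] (a.symm^[n] (b^[n] x)) = b^[n] x :=
    Function.LeftInverse.iterate a.apply_symm_apply n _
  rw [wanderingMap_eq hbU hab hb hn, wanderingMap_eq (n := n)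
    (fun y hy => hab y hy ▸ hbU y hy) (fun y hy => (hab y hy).symm) ha (by rwa [h1]), h1]
  exact Function.LeftInverse.iterate b.symm_apply_apply n _

/-- Two homeomorphisms which agree on an open set `U` that they map into itself and that absorbs
all their orbits are conjugate, by a homeomorphism which is the identity on `U` and commutes with
every common symmetry. -/
theorem exists_homeomorph_semiconj (a b : X ≃ₜ X) (hU : IsOpen U) (hbU : ∀ x ∈ U, b x ∈ U)
    (hab : ∀ x ∈ U, a x = b x) (hb : ∀ x, ∃ n : ℕ, b^[n] x ∈ U)
    (ha : ∀ x, ∃ n : ℕ, a^[n] x ∈ U) :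
    ∃ φ : X ≃ₜ X, (∀ x ∈ U, φ x = x) ∧ (∀ x, φ (b x) = a (φ x)) ∧
      ∀ σ : X → X, (∀ x, σ (a x) = a (σ x)) → (∀ x, σ (b x) = b (σ x)) →
        ∀ x, φ (σ x) = σ (φ x) := by
  have haU : ∀ x ∈ U, a x ∈ U := fun y hy => hab y hy ▸ hbU y hy
  have hba : ∀ x ∈ U, b x = a x := fun y hy => (hab y hy).symm
  have key : ∀ x n, b^[n] x ∈ U → wanderingMap a b hb x = a.symm^[n] (b^[n] x) :=
    fun x n hn => wanderingMap_eq hbU hab hb hn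
  refine ⟨⟨⟨wanderingMap a b hb, wanderingMap b a ha,
    wanderingMap_wanderingMap hbU hab hb ha, wanderingMap_wanderingMap haU hba ha hb⟩,
    continuous_wanderingMap hU hbU hab hb, continuous_wanderingMap hU haU hba ha⟩, ?_, ?_, ?_⟩
  · intro x hx
    exact key x 0 hx
  · intro x
    obtain ⟨n, hn⟩ := hb x
    have h1 : b^[n] (b x) ∈ U := by
      rw [← Function.iterate_succ_apply]
      exact iterate_mem_of_le hbU n.le_succ hn
    refine (key _ n h1).trans (Eq.trans ?_ (congrArg a (key x (n + 1) ?_).symm))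
    · rw [Function.iterate_succ_apply' a.symm, a.apply_symm_apply, Function.iterate_succ_apply]
    · exact h1
  · intro σ hσa hσb x
    obtain ⟨n, hn⟩ := hb x
    obtain ⟨m, hm⟩ := hb (σ x)
    have hσa' : ∀ x, σ (a.symm x) = a.symm (σ x) := fun y => by
      rw [← a.symm_apply_apply (σ (a.symm y)), ← hσa, a.apply_symm_apply]
    refine (key _ (max n m) (iterate_mem_of_le hbU (le_max_right _ _) hm)).trans
      (Eq.trans ?_ (congrArg σ
        (key _ (max n m) (iterate_mem_of_le hbU (le_max_left _ _) hn)).symm))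
    have e1 : ∀ k y, σ (b^[k] y) = b^[k] (σ y) := fun k =>
      (Function.Commute.iterate_right (f := σ) (g := b) (fun y => hσb y) k)
    have e2 : ∀ k y, σ (a.symm^[k] y) = a.symm^[k] (σ y) := fun k =>
      (Function.Commute.iterate_right (f := σ) (g := a.symm) (fun y => hσa' y) k)
    rw [← e1, e2]

end Wandering

/-- The homeomorphism of `X × ℝ` acting by `v` on the second factor. -/
def vert (X : Type*) [TopologicalSpace X] (v : ℝ ≃ₜ ℝ) : X × ℝ ≃ₜ X × ℝ :=
  (Homeomorph.refl X).prodCongr v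

theorem vert_apply {X : Type*} [TopologicalSpace X] (v : ℝ ≃ₜ ℝ) (x : X × ℝ) :
    vert X v x = (x.1, v x.2) := rfl

theorem vert_symm {X : Type*} [TopologicalSpace X] (v : ℝ ≃ₜ ℝ) :
    (vert X v).symm = vert X v.symm := rfl

theorem exists_iterate_mem {X : Type*} {f : X → X} {S : Set X} (η : X → ℝ) (c : ℝ)
    (hc : ∀ x ∉ S, c ≤ η x) (hf : ∀ x ∉ S, f x ∈ S ∨ η (f x) ≤ η x - 1) (x : X) :
    ∃ n : ℕ, f^[n] x ∈ S := by
  by_contra! H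
  have step : ∀ n : ℕ, η (f^[n] x) ≤ η x - n := by
    intro n
    induction n with
    | zero => simp
    | succ k ih =>
      have hk := H (k + 1)
      rw [Function.iterate_succ_apply'] at hk ⊢
      have := (hf _ (H k)).resolve_left hk
      push_cast
      linarith
  obtain ⟨n, hn⟩ := exists_nat_gt (η x - c)
  linarith [step n, hc _ (H n)]

/-- A homeomorphism of `X × ℝ` which looks like the unit translation far down, and eventually
moves every point down, is conjugate to the unit translation. -/
theorem exists_conj_vert_translation {X : Type*} [TopologicalSpace X] (a : X × ℝ ≃ₜ X × ℝ)
    (h0 : ∀ x : X × ℝ, x.2 < 0 → a x = (x.1, x.2 - 1))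
    (h1 : ∀ x : X × ℝ, 0 ≤ x.2 → (a x).2 ≤ x.2 - 1) :
    ∃ φ : X × ℝ ≃ₜ X × ℝ, ∀ x, φ (vert X (Homeomorph.addRight (-1 : ℝ)) x) = a (φ x) := by
  obtain ⟨φ, -, h, -⟩ := exists_homeomorph_semiconj (U := {x : X × ℝ | x.2 < 0}) a
    (vert X (Homeomorph.addRight (-1 : ℝ))) (isOpen_lt continuous_snd continuous_const)
    (fun x hx => by simp only [mem_ofPred_eq, vert_apply, Homeomorph.coe_addRight] at *; linarith)
    (fun x hx => by
      rw [h0 x hx]; simp only [vert_apply, Homeomorph.coe_addRight, sub_eq_add_neg])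
    (exists_iterate_mem Prod.snd 0 (fun x hx => not_lt.1 hx) fun x _ => Or.inr (by
      simp only [vert_apply, Homeomorph.coe_addRight]; linarith))
    (exists_iterate_mem Prod.snd 0 (fun x hx => not_lt.1 hx) fun x hx =>
      Or.inr (h1 x (not_lt.1 hx)))
  exact ⟨φ, h⟩

/-- `g` is a product of exactly `n` conjugates of `θ`. -/
def IsConjProd {G : Type*} [Group G] (θ : G) (n : ℕ) (g : G) : Prop :=
  ∃ L : List G, L.length = n ∧ (∀ x ∈ L, ∃ g : G, x = g * θ * g⁻¹) ∧ g = L.prod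

namespace IsConjProd

variable {G : Type*} [Group G] {θ g h : G} {m n : ℕ}

theorem conj_self (θ g : G) : IsConjProd θ 1 (g * θ * g⁻¹) :=
  ⟨[g * θ * g⁻¹], rfl, fun x hx => ⟨g, by simpa using hx⟩, by simp⟩

theorem self (θ : G) : IsConjProd θ 1 θ := by simpa using conj_self θ 1

theorem mul (hg : IsConjProd θ m g) (hh : IsConjProd θ n h) : IsConjProd θ (m + n) (g * h) := by
  obtain ⟨L, rfl, hL, rfl⟩ := hg
  obtain ⟨K, rfl, hK, rfl⟩ := hh
  refine ⟨L ++ K, by simp, fun x hx => ?_, by simp⟩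
  rcases List.mem_append.1 hx with hx | hx
  exacts [hL x hx, hK x hx]

theorem conj (hg : IsConjProd θ n g) (k : G) : IsConjProd θ n (k * g * k⁻¹) := by
  obtain ⟨L, rfl, hL, rfl⟩ := hg
  refine ⟨L.map (MulAut.conj k), by simp, fun x hx => ?_, ?_⟩
  · obtain ⟨y, hy, rfl⟩ := List.mem_map.1 hx
    obtain ⟨p, rfl⟩ := hL y hy
    exact ⟨k * p, by simp [mul_assoc]⟩
  · rw [← map_list_prod, MulAut.conj_apply]

theorem of_conj {k : G} (h : IsConjProd θ n (k * g * k⁻¹)) : IsConjProd θ n g := by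
  simpa [mul_assoc] using h.conj k⁻¹

end IsConjProd

theorem exists_homeomorph_eq {f : ℝ → ℝ} (hf : StrictMono f) (hc : Continuous f)
    (hle : ∀ s, s ≤ f s) {c d : ℝ} (hd : ∀ s ≤ c, f s ≤ s + d) : ∃ v : ℝ ≃ₜ ℝ, ∀ s, v s = f s := by
  have hs : Function.Surjective f := by
    refine hc.surjective (tendsto_atTop_mono hle tendsto_id) ?_
    refine tendsto_atBot_mono' _ ?_ (tendsto_atBot_add_const_right _ d tendsto_id)
    filter_upwards [eventually_le_atBot c] with s hs using hd s hs
  exact ⟨(hf.orderIsoOfSurjective f hs).toHomeomorph, fun s => rfl⟩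

/-- The translation by `c` of the second factor of `X × ℝ`. -/
abbrev vertTranslation (X : Type*) [TopologicalSpace X] (c : ℝ) : X × ℝ ≃ₜ X × ℝ :=
  vert X (Homeomorph.addRight c)

theorem exists_monotone_bound {X : Type*} [TopologicalSpace X] [CompactSpace X]
    {f : X × ℝ → ℝ} (hf : Continuous f) (hf0 : ∀ x, f (x, 0) = 0) :
    ∃ M : ℝ → ℝ, Continuous M ∧ Monotone M ∧ (∀ s, 0 ≤ M s) ∧ (∀ s ≤ 0, M s = 0) ∧
      ∀ x s, 0 ≤ s → f (x, s) ≤ M s := by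
  let F : ℝ → X × ℝ → ℝ := fun s p => max 0 (f (p.1, p.2 * max s 0))
  let K : Set (X × ℝ) := univ ×ˢ Icc 0 1
  have hK : IsCompact K := isCompact_univ.prod isCompact_Icc
  have hF : Continuous (fun q : ℝ × (X × ℝ) => F q.1 q.2) := by
    dsimp only [F]; fun_prop
  have hFs : ∀ s, Continuous (F s) := fun s => hF.comp (Continuous.prodMk_right s)
  have hb : ∀ s, BddAbove (F s '' K) := fun s => hK.bddAbove_image (hFs s).continuousOn
  have h0 : ∀ s, ∀ y ∈ F s '' K, 0 ≤ y := by
    rintro s _ ⟨p, -, rfl⟩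
    exact le_max_left _ _
  have hpos : ∀ s, 0 ≤ sSup (F s '' K) := fun s => Real.sSup_nonneg (h0 s)
  refine ⟨fun s => sSup (F s '' K), hK.continuous_sSup hF, ?_, hpos, ?_, ?_⟩
  · intro s s' hss
    refine Real.sSup_le ?_ (hpos s')
    rintro _ ⟨⟨x, l⟩, ⟨-, hl⟩, rfl⟩
    rcases le_or_gt s 0 with hs | hs
    · simp only [F, max_eq_right hs, mul_zero, hf0, max_self]
      exact hpos s'
    · refine le_csSup (hb s') ⟨(x, l * s / s'), ⟨mem_univ _, ?_, ?_⟩, ?_⟩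
      · exact div_nonneg (mul_nonneg hl.1 hs.le) (hs.le.trans hss)
      · refine div_le_one_of_le₀ ?_ (hs.le.trans hss)
        nlinarith [hl.2]
      · have : s' ≠ 0 := (hs.trans_le hss).ne'
        simp only [F, max_eq_left hs.le, max_eq_left (hs.le.trans hss)]
        rw [div_mul_cancel₀ _ this]
  · intro s hs
    refine le_antisymm (Real.sSup_le ?_ le_rfl) (hpos s)
    rintro _ ⟨p, -, rfl⟩
    simp [F, max_eq_right hs, hf0]
  · intro x s hs
    refine le_trans ?_ (le_csSup (hb s) ⟨(x, 1), ⟨mem_univ _, by simp⟩, rfl⟩)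
    simp [F, max_eq_left hs]

/-- A homeomorphism which is the identity on the lower half of `X × ℝ` is the product of a conjugate
of the unit translation and a conjugate of its inverse. -/
theorem exists_eq_conj_mul_conj {X : Type*} [TopologicalSpace X] [CompactSpace X]
    (g : X × ℝ ≃ₜ X × ℝ) (hg : ∀ x : X × ℝ, x.2 ≤ 0 → g x = x) :
    ∃ φ ψ : X × ℝ ≃ₜ X × ℝ, g = φ * (vertTranslation X (-1))⁻¹ * φ⁻¹ *
      (ψ * vertTranslation X (-1) * ψ⁻¹) := by
  have hg' : ∀ x : X × ℝ, x.2 ≤ 0 → g.symm x = x := fun x hx => by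
    rw [Homeomorph.symm_apply_eq, hg x hx]
  obtain ⟨M, hMc, hMm, hM0, hMz, hM⟩ := exists_monotone_bound
    (f := fun x => (g.symm x).2) (by fun_prop) (fun x => by rw [hg' _ le_rfl])
  obtain ⟨t, ht⟩ := exists_homeomorph_eq (f := fun s => s + 1 + M (s + 1)) (c := -1) (d := 1)
    (fun s s' h => by have := hMm (show s + 1 ≤ s' + 1 by linarith); dsimp only; linarith)
    (by fun_prop) (fun s => by have := hM0 (s + 1); linarith)
    (fun s hs => by rw [hMz _ (by linarith)]; linarith)
  have htm : StrictMono t := fun s s' h => by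
    have := hMm (show s + 1 ≤ s' + 1 by linarith)
    rw [ht, ht]
    linarith
  have htle : ∀ s y, y ≤ s + M s → t.symm y ≤ s - 1 := fun s y hy => by
    rw [← htm.le_iff_le, t.apply_symm_apply, ht]
    simpa using hy
  have hteq : ∀ s ≤ 0, t.symm s = s - 1 := fun s hs => by
    rw [Homeomorph.symm_apply_eq, ht]
    simp [hMz s hs]
  obtain ⟨ψ, hψ⟩ := exists_conj_vert_translation (vert X t).symm
    (fun x hx => by rw [vert_symm, vert_apply, hteq _ hx.le])
    (fun x hx => htle _ _ (by have := hM0 x.2; linarith))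
  obtain ⟨φ, hφ⟩ := exists_conj_vert_translation (g.symm.trans (vert X t).symm)
    (fun x hx => by
      rw [Homeomorph.trans_apply, hg' x hx.le, vert_symm, vert_apply, hteq _ hx.le])
    (fun x hx => htle _ (g.symm x).2 (by have := hM x.1 x.2 hx; linarith))
  have e1 : ψ * vertTranslation X (-1) * ψ⁻¹ = (vert X t)⁻¹ :=
    mul_inv_eq_of_eq_mul (Homeomorph.ext hψ)
  have e2 : φ * vertTranslation X (-1) * φ⁻¹ = (vert X t)⁻¹ * g⁻¹ :=
    mul_inv_eq_of_eq_mul (Homeomorph.ext hφ)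
  refine ⟨φ, ψ, ?_⟩
  have e3 : φ * (vertTranslation X (-1))⁻¹ * φ⁻¹ = (φ * vertTranslation X (-1) * φ⁻¹)⁻¹ := by
    simp [mul_assoc]
  rw [e1, e3, e2]
  simp

/-- The involution `(z, s) ↦ (z⁻¹, -s)` of the annulus. -/
noncomputable def annulusFlip : Circle × ℝ ≃ₜ Circle × ℝ :=
  (Homeomorph.inv Circle).prodCongr (Homeomorph.neg ℝ)

/-- The rotation by `w` composed with the translation by `c`. -/
noncomputable def annulusShift (w : Circle) (c : ℝ) : Circle × ℝ ≃ₜ Circle × ℝ :=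
  (Homeomorph.mulLeft w).prodCongr (Homeomorph.addRight c)

theorem annulusFlip_apply (x : Circle × ℝ) : annulusFlip x = (x.1⁻¹, -x.2) := rfl

theorem annulusShift_apply (w : Circle) (c : ℝ) (x : Circle × ℝ) :
    annulusShift w c x = (w * x.1, x.2 + c) := rfl

theorem annulusFlip_sq : annulusFlip ^ 2 = 1 := by
  rw [pow_two]
  refine Homeomorph.ext fun x => ?_
  change annulusFlip (annulusFlip x) = x
  simp [annulusFlip_apply]

theorem annulusShift_mul (w w' : Circle) (c c' : ℝ) :
    annulusShift w c * annulusShift w' c' = annulusShift (w * w') (c + c') := by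
  refine Homeomorph.ext fun x => ?_
  change annulusShift w c (annulusShift w' c' x) = _
  simp only [annulusShift_apply]
  refine Prod.ext ?_ ?_
  · simp [mul_assoc]
  · simp; ring

theorem annulusShift_inv (w : Circle) (c : ℝ) :
    (annulusShift w c)⁻¹ = annulusShift w⁻¹ (-c) := by
  rw [inv_eq_iff_mul_eq_one, annulusShift_mul]
  refine Homeomorph.ext fun x => ?_
  change _ = x
  simp [annulusShift_apply]

theorem isConjProd_annulusShift (w : Circle) (c : ℝ) :
    IsConjProd annulusFlip 2 (annulusShift w c) := by
  obtain ⟨a, rfl⟩ := Circle.exp_surjective w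
  have e : annulusShift (Circle.exp a) c = annulusShift (Circle.exp (a / 2)) (c / 2) * annulusFlip *
      (annulusShift (Circle.exp (a / 2)) (c / 2))⁻¹ * annulusFlip := by
    rw [annulusShift_inv]
    refine Homeomorph.ext fun x => ?_
    change _ = annulusShift (Circle.exp (a / 2)) (c / 2) (annulusFlip
      (annulusShift (Circle.exp (a / 2))⁻¹ (-(c / 2)) (annulusFlip x)))
    simp only [annulusShift_apply, annulusFlip_apply]
    refine Prod.ext ?_ ?_
    · simp only [mul_inv_rev, inv_inv]
      rw [mul_comm x.1, ← mul_assoc, ← Circle.exp_add, add_halves]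
    · simp only; ring
  rw [e]
  exact (IsConjProd.conj_self _ _).mul (IsConjProd.self _)

theorem vertTranslation_eq_annulusShift (c : ℝ) :
    vertTranslation Circle c = annulusShift 1 c :=
  Homeomorph.ext fun x => by rw [annulusShift_apply, one_mul]; rfl

theorem isConjProd_of_eq_self_below {g : Circle × ℝ ≃ₜ Circle × ℝ} {c : ℝ}
    (hg : ∀ x : Circle × ℝ, x.2 ≤ c → g x = x) : IsConjProd annulusFlip 4 g := by
  refine IsConjProd.of_conj (k := annulusShift 1 (-c)) ?_
  obtain ⟨φ, ψ, h⟩ := exists_eq_conj_mul_conj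
    (annulusShift 1 (-c) * g * (annulusShift 1 (-c))⁻¹) (fun x hx => by
      rw [annulusShift_inv]
      change annulusShift 1 (-c) (g (annulusShift 1⁻¹ (- -c) x)) = x
      rw [hg _ (by simpa [annulusShift_apply] using hx)]
      simp [annulusShift_apply])
  rw [h, vertTranslation_eq_annulusShift, annulusShift_inv]
  exact ((isConjProd_annulusShift _ _).conj φ).mul ((isConjProd_annulusShift _ _).conj ψ)

theorem isConjProd_of_eq_self_above {g : Circle × ℝ ≃ₜ Circle × ℝ} {c : ℝ}
    (hg : ∀ x : Circle × ℝ, c ≤ x.2 → g x = x) : IsConjProd annulusFlip 4 g := by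
  refine IsConjProd.of_conj (k := annulusFlip) (isConjProd_of_eq_self_below (c := -c) fun x hx => ?_)
  have hinv : annulusFlip⁻¹ = annulusFlip :=
    inv_eq_of_mul_eq_one_left (by rw [← pow_two, annulusFlip_sq])
  rw [hinv]
  change annulusFlip (g (annulusFlip x)) = x
  rw [hg _ (by simp only [annulusFlip_apply]; linarith)]
  simp [annulusFlip_apply]

/-- A multiplicative relation which is total in its first argument and relates `1` only to `1`
relates every element of the commutator subgroup to `1`. -/
theorem rel_one_of_mem_commutator {G M : Type*} [Group G] [CommMonoid M] (R : G → M → Prop)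
    (hmul : ∀ g h m n, R g m → R h n → R (g * h) (m * n)) (hone : ∀ m, R 1 m → m = 1)
    (h1 : R 1 1) (htot : ∀ g, ∃ m, R g m) {g : G} (hg : g ∈ commutator G) : R g 1 := by
  have hinv : ∀ g m n, R g m → R g⁻¹ n → m * n = 1 := fun g m n hm hn =>
    hone _ (by simpa using hmul _ _ _ _ hm hn)
  rw [commutator_eq_closure] at hg
  induction hg using Subgroup.closure_induction with
  | mem x hx =>
    obtain ⟨a, b, rfl⟩ := hx
    obtain ⟨m, hm⟩ := htot a
    obtain ⟨n, hn⟩ := htot b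
    obtain ⟨m', hm'⟩ := htot a⁻¹
    obtain ⟨n', hn'⟩ := htot b⁻¹
    have h := hmul _ _ _ _ (hmul _ _ _ _ (hmul _ _ _ _ hm hn) hm') hn'
    have e : m * n * m' * n' = 1 := by
      rw [mul_right_comm m n m', hinv a m m' hm hm', one_mul, hinv b n n' hn hn']
    rwa [e] at h
  | one => exact h1
  | mul x y _ _ hx hy => simpa using hmul _ _ _ _ hx hy
  | inv x _ hx =>
    obtain ⟨m, hm⟩ := htot x⁻¹
    have := hinv x 1 m hx hm
    rw [one_mul] at this
    rwa [this] at hm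

section Ends

variable {X : Type*}

/-- The filter of neighbourhoods of the upper end of `X × ℝ`. -/
def topEnd (X : Type*) : Filter (X × ℝ) := comap Prod.snd atTop

/-- The filter of neighbourhoods of the lower end of `X × ℝ`. -/
def botEnd (X : Type*) : Filter (X × ℝ) := comap Prod.snd atBot

theorem tendsto_topEnd_topEnd {f : X × ℝ → X × ℝ} :
    Tendsto f (topEnd X) (topEnd X) ↔ ∀ T : ℝ, ∃ R : ℝ, ∀ x, R ≤ x.2 → T ≤ (f x).2 := by
  rw [topEnd, tendsto_comap_iff, tendsto_atTop]
  refine forall_congr' fun T => ?_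
  rw [eventually_comap, eventually_atTop]
  exact ⟨fun ⟨R, hR⟩ => ⟨R, fun x hx => hR _ hx x rfl⟩,
    fun ⟨R, hR⟩ => ⟨R, fun s hs x hx => hR x (hx ▸ hs)⟩⟩

theorem tendsto_botEnd_botEnd {f : X × ℝ → X × ℝ} :
    Tendsto f (botEnd X) (botEnd X) ↔ ∀ T : ℝ, ∃ R : ℝ, ∀ x, x.2 ≤ R → (f x).2 ≤ T := by
  rw [botEnd, tendsto_comap_iff, tendsto_atBot]
  refine forall_congr' fun T => ?_
  rw [eventually_comap, eventually_atBot]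
  exact ⟨fun ⟨R, hR⟩ => ⟨R, fun x hx => hR _ hx x rfl⟩,
    fun ⟨R, hR⟩ => ⟨R, fun s hs x hx => hR x (hx ▸ hs)⟩⟩

theorem disjoint_topEnd_botEnd : Disjoint (topEnd X) (botEnd X) :=
  disjoint_comap (disjoint_atTop_atBot (α := ℝ))

instance [Nonempty X] : (topEnd X).NeBot :=
  Filter.NeBot.comap_of_surj inferInstance Prod.snd_surjective

instance [Nonempty X] : (botEnd X).NeBot :=
  Filter.NeBot.comap_of_surj inferInstance Prod.snd_surjective

variable [TopologicalSpace X]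

theorem topEnd_le_cocompact : topEnd X ≤ cocompact (X × ℝ) := by
  intro s hs
  obtain ⟨K, hK, hKs⟩ := mem_cocompact.1 hs
  obtain ⟨B, hB⟩ := (hK.image continuous_snd).bddAbove
  refine mem_comap.2 ⟨Ioi B, Ioi_mem_atTop B, fun x hx => hKs fun hxK => ?_⟩
  exact not_lt.2 (hB ⟨x, hxK, rfl⟩) hx

theorem botEnd_le_cocompact : botEnd X ≤ cocompact (X × ℝ) := by
  intro s hs
  obtain ⟨K, hK, hKs⟩ := mem_cocompact.1 hs
  obtain ⟨B, hB⟩ := (hK.image continuous_snd).bddBelow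
  refine mem_comap.2 ⟨Iio B, Iio_mem_atBot B, fun x hx => hKs fun hxK => ?_⟩
  exact not_lt.2 (hB ⟨x, hxK, rfl⟩) hx

/-- `g` preserves (`ε = 1`) or exchanges (`ε = -1`) the ends of `X × ℝ`. -/
def ActsOnEnds (g : X × ℝ ≃ₜ X × ℝ) (ε : ℤˣ) : Prop :=
  (ε = 1 ∧ Tendsto g (topEnd X) (topEnd X) ∧ Tendsto g (botEnd X) (botEnd X)) ∨
    (ε = -1 ∧ Tendsto g (topEnd X) (botEnd X) ∧ Tendsto g (botEnd X) (topEnd X))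

theorem ActsOnEnds.mul {g h : X × ℝ ≃ₜ X × ℝ} {ε δ : ℤˣ} (hg : ActsOnEnds g ε)
    (hh : ActsOnEnds h δ) : ActsOnEnds (g * h) (ε * δ) := by
  change (_ ∧ Tendsto (g ∘ h) _ _ ∧ Tendsto (g ∘ h) _ _) ∨
    (_ ∧ Tendsto (g ∘ h) _ _ ∧ Tendsto (g ∘ h) _ _)
  rcases hg with ⟨rfl, a, b⟩ | ⟨rfl, a, b⟩ <;> rcases hh with ⟨rfl, c, d⟩ | ⟨rfl, c, d⟩
  · exact Or.inl ⟨by simp, a.comp c, b.comp d⟩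
  · exact Or.inr ⟨by simp, b.comp c, a.comp d⟩
  · exact Or.inr ⟨by simp, a.comp c, b.comp d⟩
  · exact Or.inl ⟨by simp, b.comp c, a.comp d⟩

variable [CompactSpace X]

/-- A proper map sends a family of connected sets leaving every compact set to an end. -/
theorem tendsto_topEnd_or_botEnd {l : Filter (X × ℝ)} [l.NeBot] {ι : Type*} {p : ι → Prop}
    {s : ι → Set (X × ℝ)} (hl : l.HasBasis p s) (hs : ∀ i, p i → IsPreconnected (s i))
    (hlc : l ≤ cocompact (X × ℝ)) (g : X × ℝ ≃ₜ X × ℝ) :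
    Tendsto g l (topEnd X) ∨ Tendsto g l (botEnd X) := by
  have key : ∀ N : ℝ, (∀ᶠ x in l, N < (g x).2) ∨ ∀ᶠ x in l, (g x).2 < -N := by
    intro N
    have hK : IsCompact ((univ : Set X) ×ˢ Icc (-|N|) |N|) := isCompact_univ.prod isCompact_Icc
    have hev : ∀ᶠ x in l, g x ∈ ((univ : Set X) ×ˢ Icc (-|N|) |N|)ᶜ :=
      (g.isClosedEmbedding.tendsto_cocompact.mono_left hlc) hK.compl_mem_cocompact
    obtain ⟨i, hi, hsub⟩ := hl.eventually_iff.1 hev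
    have hpre : IsPreconnected ((fun x => (g x).2) '' s i) :=
      (hs i hi).image _ (continuous_snd.comp g.continuous).continuousOn
    have hout : ∀ x ∈ s i, |N| < (g x).2 ∨ (g x).2 < -|N| := by
      intro x hx
      by_contra! h
      exact hsub hx ⟨mem_univ _, h.2, h.1⟩
    obtain ⟨x₀, hx₀⟩ := l.nonempty_of_mem (hl.mem_of_mem hi)
    have hN := le_abs_self N
    rcases hout x₀ hx₀ with h0 | h0
    · left
      filter_upwards [hl.mem_of_mem hi] with x hx
      rcases hout x hx with h | h
      · linarith
      · have := hpre.ordConnected.out ⟨x, hx, rfl⟩ ⟨x₀, hx₀, rfl⟩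
        obtain ⟨y, hy, hy'⟩ := this (show (0 : ℝ) ∈ _ from
          ⟨by have := abs_nonneg N; dsimp only; linarith,
            by have := abs_nonneg N; dsimp only; linarith⟩)
        dsimp only at hy'
        have := abs_nonneg N
        rcases hout y hy with h | h <;> linarith
    · right
      filter_upwards [hl.mem_of_mem hi] with x hx
      rcases hout x hx with h | h
      · have := hpre.ordConnected.out ⟨x₀, hx₀, rfl⟩ ⟨x, hx, rfl⟩
        obtain ⟨y, hy, hy'⟩ := this (show (0 : ℝ) ∈ _ from
          ⟨by have := abs_nonneg N; dsimp only; linarith,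
            by have := abs_nonneg N; dsimp only; linarith⟩)
        dsimp only at hy'
        have := abs_nonneg N
        rcases hout y hy with h | h <;> linarith
      · linarith
  by_cases h : ∀ N : ℝ, ∀ᶠ x in l, N < (g x).2
  · left
    rw [topEnd, tendsto_comap_iff, tendsto_atTop]
    exact fun N => (h N).mono fun x hx => hx.le
  · right
    obtain ⟨N₀, hN₀⟩ := not_forall.1 h
    rw [botEnd, tendsto_comap_iff, tendsto_atBot]
    intro N
    rcases key (max N₀ (-N)) with h | h
    · exact absurd (h.mono fun x hx => (le_max_left _ _).trans_lt hx) hN₀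
    · refine h.mono fun x hx => ?_
      have := le_max_right N₀ (-N)
      simp only [Function.comp_apply]
      linarith

variable [ConnectedSpace X]

theorem tendsto_topEnd_cases (g : X × ℝ ≃ₜ X × ℝ) :
    Tendsto g (topEnd X) (topEnd X) ∨ Tendsto g (topEnd X) (botEnd X) := by
  refine tendsto_topEnd_or_botEnd (atTop_basis.comap Prod.snd) (fun i _ => ?_) topEnd_le_cocompact g
  rw [← univ_prod]
  exact isPreconnected_univ.prod isPreconnected_Ici

theorem tendsto_botEnd_cases (g : X × ℝ ≃ₜ X × ℝ) :
    Tendsto g (botEnd X) (topEnd X) ∨ Tendsto g (botEnd X) (botEnd X) := by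
  refine tendsto_topEnd_or_botEnd (atBot_basis.comap Prod.snd) (fun i _ => ?_) botEnd_le_cocompact g
  rw [← univ_prod]
  exact isPreconnected_univ.prod isPreconnected_Iic

theorem exists_actsOnEnds (g : X × ℝ ≃ₜ X × ℝ) : ∃ ε, ActsOnEnds g ε := by
  have hdisj := disjoint_topEnd_botEnd (X := X)
  have e : ⇑g ∘ ⇑g.symm = id := funext g.apply_symm_apply
  rcases tendsto_topEnd_cases g with a | a <;> rcases tendsto_botEnd_cases g with b | b
  · have h : Tendsto (⇑g ∘ ⇑g.symm) (botEnd X) (topEnd X) := by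
      rcases tendsto_botEnd_cases g.symm with c | c
      exacts [a.comp c, b.comp c]
    rw [e] at h
    exact absurd h (tendsto_id.not_tendsto hdisj.symm)
  · exact ⟨1, Or.inl ⟨rfl, a, b⟩⟩
  · exact ⟨-1, Or.inr ⟨rfl, a, b⟩⟩
  · have h : Tendsto (⇑g ∘ ⇑g.symm) (topEnd X) (botEnd X) := by
      rcases tendsto_topEnd_cases g.symm with c | c
      exacts [a.comp c, b.comp c]
    rw [e] at h
    exact absurd h (tendsto_id.not_tendsto hdisj)

theorem tendsto_ends_of_mem_commutator {g : X × ℝ ≃ₜ X × ℝ}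
    (hg : g ∈ commutator (X × ℝ ≃ₜ X × ℝ)) :
    Tendsto g (topEnd X) (topEnd X) ∧ Tendsto g (botEnd X) (botEnd X) := by
  have h1 : ActsOnEnds (1 : X × ℝ ≃ₜ X × ℝ) 1 := Or.inl ⟨rfl, tendsto_id, tendsto_id⟩
  have h := rel_one_of_mem_commutator ActsOnEnds (fun g h m n hg hh => hg.mul hh) ?_ h1
    exists_actsOnEnds hg
  · rcases h with ⟨-, h⟩ | ⟨h, -⟩
    · exact h
    · exact absurd h (by decide)
  · rintro m (⟨h, -⟩ | ⟨-, h, -⟩)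
    · exact h
    · exact absurd h (tendsto_id.not_tendsto (disjoint_topEnd_botEnd (X := X)))

end Ends

section Core

variable {X : Type*} [TopologicalSpace X]

theorem exists_periodic_of_bounds (h : X × ℝ ≃ₜ X × ℝ) {T : ℝ} (hT : 1 ≤ T)
    (h1 : ∀ x, x.2 ≤ 3 / 2 → (h x).2 < T) (h2 : ∀ x, 0 ≤ x.2 → -T < (h x).2)
    (h3 : ∀ x, 1 + 2 * T ≤ x.2 → 3 * T ≤ (h x).2) :
    ∃ k : X × ℝ ≃ₜ X × ℝ, (∀ x, 1 < x.2 → x.2 < 3 / 2 → k x = h x) ∧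
      (∀ x, k (vertTranslation X (2 * T) x) = vertTranslation X (2 * T) (k x)) ∧
      ∀ σ : X → X, (∀ x, h (Prod.map σ id x) = Prod.map σ id (h x)) →
        ∀ x, k (Prod.map σ id x) = Prod.map σ id (k x) := by
  obtain ⟨v, hv⟩ := exists_homeomorph_eq
    (f := fun s => max s (min ((1 + 2 * T) * s) (s + 2 * T))) (c := 0) (d := 0)
    (fun s s' hs => max_lt_max hs (min_lt_min (by nlinarith) (by linarith))) (by fun_prop)
    (fun s => le_max_left _ _)
    (fun s hs => by
      rw [add_zero]; exact max_le le_rfl ((min_le_left _ _).trans (by nlinarith)))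
  obtain ⟨u, hu⟩ := exists_homeomorph_eq
    (f := fun s => max s (min (s + 2 * T) (s / 2 + 3 * T / 2))) (c := 0) (d := 2 * T)
    (fun s s' hs => max_lt_max hs (min_lt_min (by linarith) (by linarith))) (by fun_prop)
    (fun s => le_max_left _ _)
    (fun s hs => max_le (by linarith) (min_le_left _ _))
  have hv0 : ∀ s ≤ 0, v s = s := fun s hs => by
    rw [hv]; exact max_eq_left ((min_le_left _ _).trans (by nlinarith))
  have hv1 : ∀ s, 1 ≤ s → v s = s + 2 * T := fun s hs => by
    rw [hv, min_eq_right (by nlinarith), max_eq_right (by linarith)]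
  have hvle : ∀ s, s ≤ v s := fun s => by rw [hv]; exact le_max_left _ _
  have hvm : StrictMono v := fun s s' hs => by
    rw [hv, hv]; exact max_lt_max hs (min_lt_min (by nlinarith) (by linarith))
  have hu0 : ∀ s ≤ -T, u s = s + 2 * T := fun s hs => by
    rw [hu, min_eq_left (by linarith), max_eq_right (by linarith)]
  have hu1 : ∀ s, 3 * T ≤ s → u s = s := fun s hs => by
    rw [hu]; exact max_eq_left ((min_le_right _ _).trans (by linarith))
  have hule : ∀ s, s ≤ u s := fun s => by rw [hu]; exact le_max_left _ _
  have hum : StrictMono u := fun s s' hs => by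
    rw [hu, hu]; exact max_lt_max hs (min_lt_min (by linarith) (by linarith))
  let α : X × ℝ ≃ₜ X × ℝ := h.symm.trans ((vert X v).trans (h.trans (vert X u)))
  let τ := vertTranslation X (2 * T)
  let β : X × ℝ ≃ₜ X × ℝ := h.symm.trans (τ.trans h)
  have hα : ∀ x, α x = vert X u (h (vert X v (h.symm x))) := fun x => rfl
  have hα' : ∀ x, α.symm x = h (vert X v.symm (h.symm (vert X u.symm x))) := fun x => rfl
  have hβ : ∀ x, β x = h (τ (h.symm x)) := fun x => rfl
  have hτ : ∀ x, τ x = (x.1, x.2 + 2 * T) := fun x => rfl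
  have hτ' : ∀ x, τ.symm x = (x.1, x.2 - 2 * T) := fun x => rfl
  have h1' : ∀ x : X × ℝ, T ≤ x.2 → 3 / 2 < (h.symm x).2 := fun x hx => by
    by_contra! hc
    have := h1 _ hc
    rw [h.apply_symm_apply] at this
    linarith
  have h2' : ∀ x : X × ℝ, x.2 ≤ -T → (h.symm x).2 < 0 := fun x hx => by
    by_contra! hc
    have := h2 _ hc
    rw [h.apply_symm_apply] at this
    linarith
  have h3' : ∀ x : X × ℝ, 1 + 2 * T ≤ (h.symm x).2 → 3 * T ≤ x.2 := fun x hx => by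
    have := h3 _ hx
    rwa [h.apply_symm_apply] at this
  obtain ⟨φ, hφU, hφc, hφσ⟩ := exists_homeomorph_semiconj (U := {x : X × ℝ | x.2 < T})
    α.symm τ.symm (isOpen_lt continuous_snd continuous_const)
    (fun x hx => by rw [mem_ofPred_eq] at *; rw [hτ']; dsimp only; linarith)
    (fun x hx => by
      rw [mem_ofPred_eq] at hx
      have e : u.symm x.2 = x.2 - 2 * T := by
        rw [Homeomorph.symm_apply_eq, hu0 _ (by linarith)]; ring
      have hlt := h2' (x.1, x.2 - 2 * T) (by dsimp only; linarith)
      rw [hα', hτ', vert_apply _ x, e, vert_apply,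
        (Homeomorph.symm_apply_eq v).2 (hv0 _ hlt.le).symm, Prod.mk.eta, h.apply_symm_apply])
    (exists_iterate_mem Prod.snd T (fun x hx => not_lt.1 hx) fun x _ => Or.inr (by
      rw [hτ']; dsimp only; linarith))
    (exists_iterate_mem (fun x => (h.symm x).2) (3 / 2) (fun x hx => (h1' x (not_lt.1 hx)).le)
      fun x hx => by
        rw [hα']
        obtain ⟨y, rfl⟩ := (vert X u).surjective x
        rw [← vert_symm u, Homeomorph.symm_apply_apply]
        rcases le_or_gt (h.symm y).2 (1 + 2 * T) with hy | hy
        · left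
          refine h1 _ (le_trans ?_ (show (1 : ℝ) ≤ 3 / 2 by norm_num))
          rw [vert_apply]
          dsimp only
          rwa [← hvm.le_iff_le, v.apply_symm_apply, hv1 1 le_rfl]
        · right
          have e : vert X u y = y := by rw [vert_apply, hu1 _ (h3' y hy.le)]
          have e' : v.symm (h.symm y).2 = (h.symm y).2 - 2 * T := by
            rw [Homeomorph.symm_apply_eq, hv1 _ (by linarith)]; ring
          rw [e, h.symm_apply_apply, vert_apply]
          dsimp only
          rw [e']
          linarith)
  obtain ⟨ψ, hψU, hψc, hψσ⟩ := exists_homeomorph_semiconj (U := {x : X × ℝ | 1 < (h.symm x).2})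
    α β (isOpen_lt continuous_const (continuous_snd.comp h.symm.continuous))
    (fun x hx => by
      rw [mem_ofPred_eq] at *; rw [hβ, h.symm_apply_apply, hτ]; dsimp only; linarith)
    (fun x hx => by
      rw [mem_ofPred_eq] at hx
      have e : vert X v (h.symm x) = τ (h.symm x) := by rw [vert_apply, hv1 _ hx.le, hτ]
      rw [hα, hβ, e, vert_apply, hu1 _ (h3 _ (by rw [hτ]; dsimp only; linarith))])
    (exists_iterate_mem (fun x => -(h.symm x).2) (-1) (fun x hx => neg_le_neg (not_lt.1 hx))
      fun x _ => Or.inr (by rw [hβ, h.symm_apply_apply, hτ]; dsimp only; linarith))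
    (exists_iterate_mem (fun x => -x.2) (-T) (fun x hx => by
        by_contra! hc
        have := h1' x (by linarith)
        exact hx (show (1:ℝ) < (h.symm x).2 by linarith))
      fun x _ => by
        rw [hα]
        rcases le_or_gt (-T) (h (vert X v (h.symm x))).2 with hy | hy
        · left
          refine lt_trans (show (1 : ℝ) < 3 / 2 by norm_num) (h1' _ ?_)
          rw [vert_apply]
          dsimp only
          have := hum.monotone hy
          rw [hu0 _ le_rfl] at this
          linarith
        · right
          have e := h2' _ hy.le
          rw [h.symm_apply_apply, vert_apply] at e
          dsimp only at e
          have e' : vert X v (h.symm x) = h.symm x := by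
            rw [vert_apply, hv0 _ ((hvle _).trans e.le)]
          rw [e', h.apply_symm_apply] at hy ⊢
          rw [vert_apply, hu0 _ hy.le]
          dsimp only
          linarith)
  refine ⟨h.trans (ψ.trans φ.symm), fun x hx hx' => ?_, fun x => ?_, fun σ hσ x => ?_⟩
  · rw [Homeomorph.trans_apply, Homeomorph.trans_apply,
      hψU _ (by rwa [mem_ofPred_eq, h.symm_apply_apply]), Homeomorph.symm_apply_eq,
      hφU _ (h1 _ hx'.le)]
  · have e1 : ∀ y, φ.symm (α y) = τ (φ.symm y) := fun y => by
      rw [Homeomorph.symm_apply_eq]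
      have := hφc (τ (φ.symm y))
      rw [τ.symm_apply_apply, φ.apply_symm_apply, Homeomorph.eq_symm_apply] at this
      exact this
    have e2 : h (τ x) = β (h x) := by rw [hβ, h.symm_apply_apply]
    change φ.symm (ψ (h (τ x))) = τ _
    rw [e2, hψc, e1]
    rfl
  · have hσ' : ∀ x, h.symm (Prod.map σ id x) = Prod.map σ id (h.symm x) := fun x => by
      rw [Homeomorph.symm_apply_eq, hσ, h.apply_symm_apply]
    have hσv : ∀ (w : ℝ ≃ₜ ℝ) x, vert X w (Prod.map σ id x) = Prod.map σ id (vert X w x) :=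
      fun w x => rfl
    have hσα : ∀ x, α.symm (Prod.map σ id x) = Prod.map σ id (α.symm x) := fun x => by
      rw [hα', hα', hσv, hσ', hσv, hσ]
    have hφσ' := hφσ (Prod.map σ id) (fun x => (hσα x).symm) (fun x => rfl)
    have hψσ' := hψσ (Prod.map σ id) (fun x => by rw [hα, hα, hσ', hσv, hσ, hσv])
      (fun x => by rw [hβ, hβ, hσ', hσv, hσ])
    change φ.symm (ψ (h _)) = _
    rw [hσ, hψσ', Homeomorph.symm_apply_eq, hφσ']
    change _ = Prod.map σ id (φ (φ.symm (ψ (h x))))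
    rw [φ.apply_symm_apply]

theorem exists_periodic (h : X × ℝ ≃ₜ X × ℝ) (ht : Tendsto h (topEnd X) (topEnd X))
    (ht' : Tendsto h.symm (topEnd X) (topEnd X)) (hb' : Tendsto h.symm (botEnd X) (botEnd X)) :
    ∃ (k : X × ℝ ≃ₜ X × ℝ) (T : ℝ), 0 < T ∧ (∀ x, 1 < x.2 → x.2 < 3 / 2 → k x = h x) ∧
      (∀ x, k (vertTranslation X T x) = vertTranslation X T (k x)) ∧
      ∀ σ : X → X, (∀ x, h (Prod.map σ id x) = Prod.map σ id (h x)) →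
        ∀ x, k (Prod.map σ id x) = Prod.map σ id (k x) := by
  obtain ⟨R₁, hR₁⟩ := tendsto_topEnd_topEnd.1 ht' 2
  obtain ⟨R₂, hR₂⟩ := tendsto_botEnd_botEnd.1 hb' (-1)
  obtain ⟨T, hT⟩ : ∃ T, T = max 1 (max R₁ (-R₂)) := ⟨_, rfl⟩
  have hT1 : 1 ≤ T := hT ▸ le_max_left _ _
  have hT2 : R₁ ≤ T := hT ▸ (le_max_left _ _).trans (le_max_right _ _)
  have hT3 : -R₂ ≤ T := hT ▸ (le_max_right _ _).trans (le_max_right _ _)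
  obtain ⟨R₃, hR₃⟩ := tendsto_topEnd_topEnd.1 ht (3 * T)
  have hc : 0 < max 1 R₃ := lt_max_of_lt_left one_pos
  have hsm : StrictMono fun s : ℝ => max s (3 / 2 + max 1 R₃ * (s - 3 / 2)) :=
    fun s s' hs => max_lt_max hs (by nlinarith)
  have hid : ∀ s ≤ 3 / 2, 3 / 2 + max 1 R₃ * (s - 3 / 2) ≤ s := fun s hs => by
    nlinarith [le_max_left 1 R₃]
  obtain ⟨v, hv⟩ := exists_homeomorph_eq (c := 3 / 2) (d := 0) hsm (by fun_prop)
    (fun s => le_max_left _ _) (fun s hs => by rw [add_zero]; exact max_le le_rfl (hid s hs))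
  have hv0 : ∀ s ≤ 3 / 2, v s = s := fun s hs => by rw [hv]; exact max_eq_left (hid s hs)
  have hvx : ∀ x : X × ℝ, x.2 ≤ 3 / 2 → vert X v x = x := fun x hx => by
    rw [vert_apply, hv0 _ hx]
  obtain ⟨k, hk1, hk2, hk3⟩ := exists_periodic_of_bounds ((vert X v).trans h) hT1
    (fun x hx => by
      rw [Homeomorph.trans_apply, hvx x hx]
      by_contra! hc
      have := hR₁ (h x) (by linarith)
      rw [h.symm_apply_apply] at this
      linarith)
    (fun x hx => by
      rw [Homeomorph.trans_apply, vert_apply]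
      by_contra! hc
      have := hR₂ _ (hc.trans (by linarith))
      rw [h.symm_apply_apply] at this
      dsimp only at this
      have h0 := le_max_left x.2 (3 / 2 + max 1 R₃ * (x.2 - 3 / 2))
      rw [← hv] at h0
      linarith)
    (fun x hx => by
      rw [Homeomorph.trans_apply, vert_apply]
      refine hR₃ _ ?_
      dsimp only
      rw [hv]
      refine le_max_of_le_right ?_
      nlinarith [le_max_left 1 R₃, le_max_right 1 R₃])
  refine ⟨k, 2 * T, by linarith, fun x hx hx' => ?_, hk2, fun σ hσ => hk3 σ fun x => ?_⟩
  · rw [hk1 x hx hx', Homeomorph.trans_apply, hvx x hx'.le]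
  · rw [Homeomorph.trans_apply, Homeomorph.trans_apply, ← hσ]
    rfl

end Core

theorem exists_bounded_of_periodic (k : ℝ × ℝ ≃ₜ ℝ × ℝ) {S T : ℝ} (hS : 0 < S) (hT : 0 < T)
    (h1 : ∀ x, k (x + (S, 0)) = k x + (S, 0)) (h2 : ∀ x, k (x + (0, T)) = k x + (0, T)) :
    ∃ C, ∀ x, ‖k x - x‖ ≤ C := by
  have p1 : Function.Periodic (fun x => k x - x) (S, 0) := fun x => by
    dsimp only; rw [h1]; abel
  have p2 : Function.Periodic (fun x => k x - x) (0, T) := fun x => by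
    dsimp only; rw [h2]; abel
  obtain ⟨C, hC⟩ := ((isCompact_Icc (a := (0 : ℝ)) (b := S)).prod
    (isCompact_Icc (a := (0 : ℝ)) (b := T))).exists_bound_of_continuousOn
    (f := fun x => k x - x) (by fun_prop)
  refine ⟨C, fun x => ?_⟩
  obtain ⟨m, hm, -⟩ := existsUnique_sub_zsmul_mem_Ico hS x.1 0
  obtain ⟨n, hn, -⟩ := existsUnique_sub_zsmul_mem_Ico hT x.2 0
  rw [zero_add] at hm hn
  have e := hC (x - m • (S, 0) - n • (0, T)) ⟨
    by simpa using (show x.1 - m • S ∈ Icc 0 S from ⟨hm.1, hm.2.le⟩),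
    by simpa using (show x.2 - n • T ∈ Icc 0 T from ⟨hn.1, hn.2.le⟩)⟩
  have e1 := (p1.zsmul m).sub_eq x
  have e2 := (p2.zsmul n).sub_eq (x - m • ((S, 0) : ℝ × ℝ))
  rw [e2, e1] at e
  exact e

/-- The universal covering map of the annulus. -/
noncomputable def annulusCover (p : ℝ × ℝ) : Circle × ℝ := (Circle.exp p.1, p.2)

theorem continuous_annulusCover : Continuous annulusCover := by
  unfold annulusCover; fun_prop

theorem annulusCover_add_int (p : ℝ × ℝ) (n : ℤ) :
    annulusCover (p + (n * (2 * Real.pi), 0)) = annulusCover p :=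
  Prod.ext (Circle.exp_eq_exp.2 ⟨n, rfl⟩) (add_zero _)

theorem exists_int_of_exp_eq {A : Type*} [TopologicalSpace A] [PreconnectedSpace A] [Nonempty A]
    {f g : A → ℝ} (hf : Continuous f) (hg : Continuous g)
    (h : ∀ a, Circle.exp (f a) = Circle.exp (g a)) :
    ∃ n : ℤ, ∀ a, f a = g a + n * (2 * Real.pi) := by
  obtain ⟨a₀⟩ := ‹Nonempty A›
  obtain ⟨n, hn⟩ := Circle.exp_eq_exp.1 (h a₀)
  refine ⟨n, fun a => congrFun (Circle.isCoveringMap_exp.eq_of_comp_eq hf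
    (g₂ := fun a => g a + n * (2 * Real.pi)) (by fun_prop) (funext fun a => ?_) a₀ hn) a⟩
  exact (h a).trans (Circle.exp_eq_exp.2 ⟨-n, by push_cast; ring⟩)

/-- The homeomorphism `h` has a lift to the universal cover, and acts on the fundamental group
by multiplication by `d`. -/
def HasLift (h : Circle × ℝ ≃ₜ Circle × ℝ) (d : ℤ) : Prop :=
  ∃ H : ℝ × ℝ → ℝ × ℝ, Continuous H ∧ (∀ p, annulusCover (H p) = h (annulusCover p)) ∧
    ∀ p, H (p + (2 * Real.pi, 0)) = H p + (d * (2 * Real.pi), 0)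

theorem exists_hasLift (h : Circle × ℝ ≃ₜ Circle × ℝ) : ∃ d, HasLift h d := by
  obtain ⟨e₀, he₀⟩ := Circle.exp_surjective (h (annulusCover 0)).1
  have hc : Continuous fun p => h (annulusCover p) := h.continuous.comp continuous_annulusCover
  obtain ⟨F, ⟨-, hF⟩, -⟩ := Circle.isCoveringMap_exp.existsUnique_continuousMap_lifts
    ⟨fun p : ℝ × ℝ => (h (annulusCover p)).1, hc.fst⟩ 0 e₀ he₀
  have hF' : ∀ p, Circle.exp (F p) = (h (annulusCover p)).1 := fun p => congrFun hF p
  have hper : ∀ p : ℝ × ℝ, annulusCover (p + (2 * Real.pi, 0)) = annulusCover p := fun p => by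
    simpa using annulusCover_add_int p 1
  obtain ⟨d, hd⟩ := exists_int_of_exp_eq (f := fun p : ℝ × ℝ => F (p + (2 * Real.pi, 0)))
    (g := fun p => F p) (by fun_prop) (by fun_prop) (fun p => by rw [hF', hF', hper])
  refine ⟨d, fun p => (F p, (h (annulusCover p)).2), F.continuous.prodMk hc.snd,
    fun p => Prod.ext (hF' p) rfl, fun p => Prod.ext (hd p) ?_⟩
  simp [hper]

theorem lift_add_int {H : ℝ × ℝ → ℝ × ℝ} {d : ℤ}
    (hH : ∀ p, H (p + (2 * Real.pi, 0)) = H p + (d * (2 * Real.pi), 0)) (n : ℤ) (p : ℝ × ℝ) :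
    H (p + (n * (2 * Real.pi), 0)) = H p + ((d * n : ℤ) * (2 * Real.pi), 0) := by
  have hper : Function.Periodic (fun p => H p - (d * p.1, 0)) (2 * Real.pi, 0) := fun p => by
    dsimp only
    rw [hH, add_sub_assoc, sub_eq_add_neg (H p)]
    congr 1
    ext <;> simp; ring
  have e : n • ((2 * Real.pi, 0) : ℝ × ℝ) = (n * (2 * Real.pi), 0) := by simp
  have := hper.zsmul n p
  rw [e, sub_eq_iff_eq_add] at this
  rw [this, sub_eq_add_neg, add_assoc]
  congr 1
  ext <;> simp; ring

theorem HasLift.mul {g h : Circle × ℝ ≃ₜ Circle × ℝ} {m n : ℤ} (hg : HasLift g m)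
    (hh : HasLift h n) : HasLift (g * h) (m * n) := by
  obtain ⟨G, hGc, hG, hGp⟩ := hg
  obtain ⟨H, hHc, hH, hHp⟩ := hh
  refine ⟨G ∘ H, hGc.comp hHc, fun p => ?_, fun p => ?_⟩
  · change annulusCover (G (H p)) = g (h (annulusCover p))
    rw [hG, hH]
  · rw [Function.comp_apply, Function.comp_apply, hHp, lift_add_int hGp]

theorem exists_int_of_lift_id {H : ℝ × ℝ → ℝ × ℝ} (hc : Continuous H)
    (h : ∀ p, annulusCover (H p) = annulusCover p) :
    ∃ n : ℤ, ∀ p, H p = p + (n * (2 * Real.pi), 0) := by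
  obtain ⟨n, hn⟩ := exists_int_of_exp_eq (f := fun p => (H p).1) (g := fun p => p.1)
    (by fun_prop) (by fun_prop) (fun p => congrArg Prod.fst (h p))
  exact ⟨n, fun p => Prod.ext (hn p) (((congrArg Prod.snd (h p))).trans (add_zero _).symm)⟩

theorem hasLift_one_of_mem_commutator {h : Circle × ℝ ≃ₜ Circle × ℝ}
    (hh : h ∈ commutator (Circle × ℝ ≃ₜ Circle × ℝ)) : HasLift h 1 := by
  refine rel_one_of_mem_commutator HasLift (fun g h m n hg hh => hg.mul hh) ?_
    ⟨id, continuous_id, fun p => rfl, fun p => by simp⟩ exists_hasLift hh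
  rintro m ⟨H, hHc, hH, hHp⟩
  obtain ⟨n, hn⟩ := exists_int_of_lift_id hHc hH
  have := congrArg Prod.fst (hHp 0)
  rw [hn, hn] at this
  simp only [Prod.fst_add, zero_add, add_comm (2 * Real.pi), add_right_inj] at this
  exact_mod_cast (mul_eq_right₀ Real.two_pi_pos.ne').1 this.symm

theorem exists_homeomorph_lift {h : Circle × ℝ ≃ₜ Circle × ℝ}
    (hh : h ∈ commutator (Circle × ℝ ≃ₜ Circle × ℝ)) :
    ∃ H : ℝ × ℝ ≃ₜ ℝ × ℝ, (∀ p, annulusCover (H p) = h (annulusCover p)) ∧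
      ∀ p, H (p + (2 * Real.pi, 0)) = H p + (2 * Real.pi, 0) := by
  obtain ⟨H, hHc, hH, hHp⟩ := hasLift_one_of_mem_commutator hh
  obtain ⟨K, hKc, hK, hKp⟩ := hasLift_one_of_mem_commutator (inv_mem hh)
  have hK' : ∀ p, annulusCover (K p) = h.symm (annulusCover p) := hK
  obtain ⟨m, hm⟩ := exists_int_of_lift_id (hHc.comp hKc)
    (fun p => by rw [Function.comp_apply, hH, hK', h.apply_symm_apply])
  obtain ⟨n, hn⟩ := exists_int_of_lift_id (hKc.comp hHc)
    (fun p => by rw [Function.comp_apply, hK', hH, h.symm_apply_apply])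
  simp only [Function.comp_apply] at hm hn
  have hr : ∀ p, H (K (p + ((-m : ℤ) * (2 * Real.pi), 0))) = p := fun p => by
    rw [hm, add_assoc]
    simp
  have hmn : n = m := by
    have e := lift_add_int hHp n 0
    rw [← hn, hm] at e
    simpa using e.symm
  refine ⟨⟨⟨H, fun p => K (p + ((-m : ℤ) * (2 * Real.pi), 0)), fun p => ?_, hr⟩, hHc, by fun_prop⟩,
    hH, fun p => by simpa using hHp p⟩
  dsimp only
  rw [lift_add_int hKp, hn, hmn, add_assoc]
  simp

section Squash

variable {E : Type*} [NormedAddCommGroup E] [NormedSpace ℝ E]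

/-- A radial homeomorphism onto the ball of radius `2` which fixes the unit ball. -/
noncomputable def squash (x : E) : E := (2 / (1 + max 1 ‖x‖)) • x

/-- The inverse of `squash`. -/
noncomputable def unsquash (y : E) : E := (min 1 (2 - ‖y‖))⁻¹ • y

theorem squash_of_norm_le_one {x : E} (hx : ‖x‖ ≤ 1) : squash x = x := by
  rw [squash, max_eq_left hx]; norm_num

theorem unsquash_of_norm_le_one {x : E} (hx : ‖x‖ ≤ 1) : unsquash x = x := by
  rw [unsquash, min_eq_left (by linarith)]; norm_num

theorem norm_squash (x : E) : ‖squash x‖ = 2 / (1 + max 1 ‖x‖) * ‖x‖ := by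
  rw [squash, norm_smul, Real.norm_of_nonneg (by positivity)]

theorem norm_squash_lt (x : E) : ‖squash x‖ < 2 := by
  rw [norm_squash, div_mul_eq_mul_div, div_lt_iff₀ (by positivity)]
  linarith [le_max_right 1 ‖x‖]

theorem unsquash_squash (x : E) : unsquash (squash x) = x := by
  rcases le_total ‖x‖ 1 with hx | hx
  · rw [squash_of_norm_le_one hx, unsquash_of_norm_le_one hx]
  · have e : 2 - ‖squash x‖ = 2 / (1 + ‖x‖) := by
      rw [norm_squash, max_eq_right hx]; field_simp; ring
    rw [unsquash, e, min_eq_right (by rw [div_le_one (by positivity)]; linarith), squash,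
      max_eq_right hx, smul_smul, inv_mul_cancel₀ (by positivity), one_smul]

theorem squash_unsquash {y : E} (hy : ‖y‖ < 2) : squash (unsquash y) = y := by
  rcases le_total ‖y‖ 1 with h | h
  · rw [unsquash_of_norm_le_one h, squash_of_norm_le_one h]
  · have h2 : 0 < 2 - ‖y‖ := by linarith
    have e : ‖unsquash y‖ = (2 - ‖y‖)⁻¹ * ‖y‖ := by
      rw [unsquash, min_eq_right (by linarith), norm_smul, Real.norm_of_nonneg (by positivity)]
    have e1 : 1 ≤ ‖unsquash y‖ := by
      rw [e, inv_mul_eq_div, le_div_iff₀ h2]; linarith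
    have e2 : 2 / (1 + (2 - ‖y‖)⁻¹ * ‖y‖) = 2 - ‖y‖ := by
      have : 1 + (2 - ‖y‖)⁻¹ * ‖y‖ = 2 * (2 - ‖y‖)⁻¹ := by field_simp; ring
      rw [this]; field_simp
    rw [squash, max_eq_right e1, e, e2, unsquash, min_eq_right (by linarith), smul_smul,
      mul_inv_cancel₀ h2.ne', one_smul]

theorem continuous_squash : Continuous (squash : E → E) := by
  unfold squash
  exact (continuous_const.div (by fun_prop) fun x => by positivity).smul continuous_id

theorem continuousAt_unsquash {y : E} (hy : ‖y‖ < 2) : ContinuousAt unsquash y := by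
  unfold unsquash
  have h : (min 1 (2 - ‖y‖)) ≠ 0 := (lt_min one_pos (by linarith)).ne'
  have hc : ContinuousAt (fun y : E => min 1 (2 - ‖y‖)) y := by fun_prop
  exact (hc.inv₀ h).smul continuousAt_id

theorem norm_squash_sub_squash_le (x y : E) :
    ‖squash x - squash y‖ ≤ 4 * ‖x - y‖ / (1 + max 1 ‖x‖) := by
  obtain ⟨a, ha⟩ : ∃ a, a = max 1 ‖x‖ := ⟨_, rfl⟩
  obtain ⟨b, hb⟩ : ∃ b, b = max 1 ‖y‖ := ⟨_, rfl⟩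
  have ha1 : 1 ≤ a := ha ▸ le_max_left _ _
  have hb1 : 1 ≤ b := hb ▸ le_max_left _ _
  have hby : ‖y‖ ≤ b := hb ▸ le_max_right _ _
  have hab : |b - a| ≤ ‖x - y‖ := by
    rw [ha, hb, norm_sub_rev, max_comm 1, max_comm 1]
    exact (abs_max_sub_max_le_abs _ _ _).trans (abs_norm_sub_norm_le y x)
  have e : squash x - squash y = (2 / (1 + a)) • (x - y) + (2 / (1 + a) - 2 / (1 + b)) • y := by
    rw [squash, squash, ← ha, ← hb, smul_sub, sub_smul]; abel
  have e2 : 2 / (1 + a) - 2 / (1 + b) = 2 / (1 + a) * ((b - a) / (1 + b)) := by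
    field_simp; ring
  rw [← ha, e, e2]
  refine (norm_add_le _ _).trans ?_
  rw [norm_smul, norm_smul, norm_mul, Real.norm_of_nonneg (by positivity), norm_div,
    Real.norm_eq_abs, Real.norm_of_nonneg (show 0 ≤ 1 + b by positivity)]
  have h1 : |b - a| / (1 + b) * ‖y‖ ≤ ‖x - y‖ := by
    rw [div_mul_eq_mul_div, div_le_iff₀ (by positivity)]
    exact mul_le_mul hab (by linarith) (norm_nonneg _) (norm_nonneg _)
  calc 2 / (1 + a) * ‖x - y‖ + 2 / (1 + a) * (|b - a| / (1 + b)) * ‖y‖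
      = 2 / (1 + a) * (‖x - y‖ + |b - a| / (1 + b) * ‖y‖) := by ring
    _ ≤ 2 / (1 + a) * (‖x - y‖ + ‖x - y‖) := by gcongr
    _ = 4 * ‖x - y‖ / (1 + a) := by ring

open Classical in
/-- The conjugate of `H` by `squash`, extended by the identity. -/
noncomputable def compress (H : E → E) (y : E) : E :=
  if ‖y‖ < 2 then squash (H (unsquash y)) else y

theorem compress_of_lt (H : E → E) {y : E} (hy : ‖y‖ < 2) :
    compress H y = squash (H (unsquash y)) := if_pos hy

theorem compress_of_le (H : E → E) {y : E} (hy : 2 ≤ ‖y‖) : compress H y = y :=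
  if_neg hy.not_gt

theorem compress_compress {H K : E → E} (h : ∀ x, H (K x) = x) (y : E) :
    compress H (compress K y) = y := by
  rcases lt_or_ge ‖y‖ 2 with hy | hy
  · rw [compress_of_lt K hy, compress_of_lt H (norm_squash_lt _), unsquash_squash, h,
      squash_unsquash hy]
  · rw [compress_of_le K hy, compress_of_le H hy]

theorem norm_compress_sub_le {H : E → E} {M : ℝ} (hM : ∀ x, ‖H x - x‖ ≤ M) (y : E) :
    ‖compress H y - y‖ ≤ 4 * M * max 0 (2 - ‖y‖) := by
  have hM0 : 0 ≤ M := (norm_nonneg _).trans (hM 0)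
  rcases lt_or_ge ‖y‖ 2 with hy | hy
  · obtain ⟨x, hx⟩ : ∃ x, x = unsquash y := ⟨_, rfl⟩
    have hxy : y = squash x := by rw [hx, squash_unsquash hy]
    rw [compress_of_lt H hy, ← hx, hxy, norm_sub_rev, max_eq_right (by linarith [norm_squash_lt x])]
    refine (norm_squash_sub_squash_le _ _).trans ?_
    have h1 : 1 / (1 + max 1 ‖x‖) ≤ 2 - ‖squash x‖ := by
      rw [norm_squash, div_mul_eq_mul_div, div_le_iff₀ (by positivity), sub_mul,
        div_mul_cancel₀ _ (by positivity)]
      linarith [le_max_right 1 ‖x‖]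
    calc 4 * ‖x - H x‖ / (1 + max 1 ‖x‖) = 4 * ‖H x - x‖ * (1 / (1 + max 1 ‖x‖)) := by
          rw [norm_sub_rev]; ring
      _ ≤ 4 * M * (2 - ‖squash x‖) := by gcongr; exact hM x
  · rw [compress_of_le H hy, sub_self, norm_zero]
    positivity

theorem continuous_compress {H : E → E} (hH : Continuous H) {M : ℝ} (hM : ∀ x, ‖H x - x‖ ≤ M) :
    Continuous (compress H) := by
  refine continuous_iff_continuousAt.2 fun y => ?_
  rcases lt_or_ge ‖y‖ 2 with hy | hy
  · have h : compress H =ᶠ[𝓝 y] fun y => squash (H (unsquash y)) := by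
      filter_upwards [continuous_norm.continuousAt.eventually_lt_const hy] with z hz
      exact compress_of_lt H hz
    refine ContinuousAt.congr ?_ h.symm
    exact continuous_squash.continuousAt.comp
      (hH.continuousAt.comp (continuousAt_unsquash hy))
  · have h0 : Tendsto (fun z => 4 * M * max 0 (2 - ‖z‖)) (𝓝 y) (𝓝 0) := by
      have : Continuous fun z : E => 4 * M * max 0 (2 - ‖z‖) := by fun_prop
      have h := this.tendsto y
      rwa [max_eq_left (by linarith), mul_zero] at h
    have h1 : Tendsto (fun z => compress H z - z) (𝓝 y) (𝓝 0) :=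
      squeeze_zero_norm (norm_compress_sub_le hM) h0
    have h2 := h1.add tendsto_id
    rw [ContinuousAt, compress_of_le H hy]
    simpa using h2

/-- A homeomorphism at bounded distance from the identity which fixes the origin agrees near the
origin with a homeomorphism supported in the ball of radius `2`. -/
theorem exists_homeomorph_eventuallyEq (H : E ≃ₜ E) {M : ℝ} (hM : ∀ x, ‖H x - x‖ ≤ M)
    (h0 : H 0 = 0) :
    ∃ F : E ≃ₜ E, (∀ x, 2 ≤ ‖x‖ → F x = x) ∧ ∀ᶠ x in 𝓝 0, F x = H x := by
  have hM' : ∀ x, ‖H.symm x - x‖ ≤ M := fun x => by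
    have := hM (H.symm x)
    rwa [H.apply_symm_apply, norm_sub_rev] at this
  refine ⟨⟨⟨compress H, compress H.symm, compress_compress H.symm_apply_apply,
    compress_compress H.apply_symm_apply⟩, continuous_compress H.continuous hM,
    continuous_compress H.symm.continuous hM'⟩, fun x hx => compress_of_le H hx, ?_⟩
  have h1 : ∀ᶠ x : E in 𝓝 0, ‖x‖ < 1 :=
    continuous_norm.continuousAt.eventually_lt_const (by simp)
  have h2 : ∀ᶠ x : E in 𝓝 0, ‖H x‖ < 1 :=
    (H.continuous.norm.continuousAt (x := 0)).eventually_lt_const (by simp [h0])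
  filter_upwards [h1, h2] with x hx hx'
  change compress H x = H x
  rw [compress_of_lt H (by linarith), unsquash_of_norm_le_one hx.le, squash_of_norm_le_one hx'.le]

end Squash

/-- The map of the annulus induced by a map of the plane supported in the ball of radius `2`. -/
noncomputable def annulusMap (F : ℝ × ℝ → ℝ × ℝ) (x : Circle × ℝ) : Circle × ℝ :=
  annulusCover (F ((x.1 : ℂ).arg, x.2))

theorem annulusCover_arg (x : Circle × ℝ) : annulusCover ((x.1 : ℂ).arg, x.2) = x :=
  Prod.ext (Circle.exp_arg x.1) rfl

theorem annulusMap_of_le {F : ℝ × ℝ → ℝ × ℝ} (hF : ∀ p, 2 ≤ ‖p‖ → F p = p) {x : Circle × ℝ}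
    (hx : 2 ≤ ‖((x.1 : ℂ).arg, x.2)‖) : annulusMap F x = x := by
  rw [annulusMap, hF _ hx, annulusCover_arg]

theorem continuous_annulusMap {F : ℝ × ℝ → ℝ × ℝ} (hc : Continuous F)
    (hF : ∀ p, 2 ≤ ‖p‖ → F p = p) : Continuous (annulusMap F) := by
  refine continuous_iff_continuousAt.2 fun x => ?_
  by_cases hx : (x.1 : ℂ) ∈ Complex.slitPlane
  · have h : ContinuousAt (fun x : Circle × ℝ => ((x.1 : ℂ).arg, x.2)) x :=
      ((Complex.continuousAt_arg hx).comp (f := fun x : Circle × ℝ => (x.1 : ℂ))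
        (by fun_prop)).prodMk continuousAt_snd
    exact continuous_annulusCover.continuousAt.comp (hc.continuousAt.comp h)
  · have hre : (x.1 : ℂ).re < Real.cos 2 := by
      have e : (x.1 : ℂ).arg = Real.pi := by
        rw [Complex.mem_slitPlane_iff_arg] at hx
        by_contra h
        exact hx ⟨h, x.1.coe_ne_zero⟩
      have : (x.1 : ℂ).re = -1 := by
        rw [← Circle.exp_arg x.1, e]; simp
      rw [this, ← Real.cos_pi]
      exact Real.cos_lt_cos_of_nonneg_of_le_pi (by norm_num) le_rfl
        (by linarith [Real.pi_gt_three])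
    have h : annulusMap F =ᶠ[𝓝 x] id := by
      have hcont : ContinuousAt (fun x : Circle × ℝ => (x.1 : ℂ).re) x := by fun_prop
      filter_upwards [hcont.eventually_lt_const hre] with y hy
      refine annulusMap_of_le hF (le_trans ?_ (norm_fst_le _))
      by_contra! hlt
      rw [← Circle.exp_arg y.1, Circle.coe_exp, Complex.exp_ofReal_mul_I_re, ← Real.cos_abs] at hy
      exact hy.not_ge (Real.cos_le_cos_of_nonneg_of_le_pi (abs_nonneg _)
        (by linarith [Real.pi_gt_three]) hlt.le)
    exact continuousAt_id.congr h.symm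

theorem annulusMap_annulusMap {F G : ℝ × ℝ → ℝ × ℝ} (hG : ∀ p, 2 ≤ ‖p‖ → G p = p)
    (h : ∀ p, G (F p) = p) (x : Circle × ℝ) :
    annulusMap G (annulusMap F x) = x := by
  rcases lt_or_ge ‖F ((x.1 : ℂ).arg, x.2)‖ 2 with hlt | hge
  · obtain ⟨h1, h2⟩ := abs_lt.1 ((norm_fst_le _).trans_lt hlt)
    have e : (((annulusMap F x).1 : ℂ).arg, (annulusMap F x).2) = F ((x.1 : ℂ).arg, x.2) :=
      Prod.ext (Circle.arg_exp (by linarith [Real.pi_gt_three]) (by linarith [Real.pi_gt_three]))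
        rfl
    rw [annulusMap, e, h, annulusCover_arg]
  · have e : F ((x.1 : ℂ).arg, x.2) = ((x.1 : ℂ).arg, x.2) := by
      rw [← hG _ hge, h]
    have e' : annulusMap F x = x := by rw [annulusMap, e, annulusCover_arg]
    rw [e', annulusMap_of_le hG (e ▸ hge)]

theorem exists_homeomorph_annulus (F : ℝ × ℝ ≃ₜ ℝ × ℝ) (hF : ∀ p, 2 ≤ ‖p‖ → F p = p) :
    ∃ f : Circle × ℝ ≃ₜ Circle × ℝ, (∀ x, 2 ≤ |x.2| → f x = x) ∧
      ∀ᶠ p in 𝓝 0, f (annulusCover p) = annulusCover (F p) := by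
  have hF' : ∀ p, 2 ≤ ‖p‖ → F.symm p = p := fun p hp => by
    rw [Homeomorph.symm_apply_eq, hF p hp]
  refine ⟨⟨⟨annulusMap F, annulusMap F.symm, annulusMap_annulusMap hF' F.symm_apply_apply,
    annulusMap_annulusMap hF F.apply_symm_apply⟩, continuous_annulusMap F.continuous hF,
    continuous_annulusMap F.symm.continuous hF'⟩, fun x hx =>
    annulusMap_of_le hF (le_trans hx (norm_snd_le ((x.1 : ℂ).arg, x.2))), ?_⟩
  have h1 : ∀ᶠ p : ℝ × ℝ in 𝓝 0, ‖p‖ < 2 :=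
    continuous_norm.continuousAt.eventually_lt_const (by simp)
  filter_upwards [h1] with p hp
  obtain ⟨h1, h2⟩ := abs_lt.1 ((norm_fst_le p).trans_lt hp)
  change annulusMap F _ = _
  have e : (((annulusCover p).1 : ℂ).arg, (annulusCover p).2) = p :=
    Prod.ext (Circle.arg_exp (by linarith [Real.pi_gt_three]) (by linarith [Real.pi_gt_three])) rfl
  rw [annulusMap, e]

/-- The parametrisation of the punctured plane by the annulus. -/
noncomputable def polar (x : Circle × ℝ) : ℂ := (Real.exp x.2 : ℂ) * x.1

/-- The inverse of `polar`. -/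
noncomputable def unpolar (w : ℂ) : Circle × ℝ := (Circle.exp w.arg, Real.log ‖w‖)

theorem norm_polar (x : Circle × ℝ) : ‖polar x‖ = Real.exp x.2 := by
  simp [polar, Circle.norm_coe]

theorem polar_ne_zero (x : Circle × ℝ) : polar x ≠ 0 := by
  rw [← norm_pos_iff, norm_polar]; positivity

theorem unpolar_polar (x : Circle × ℝ) : unpolar (polar x) = x := by
  refine Prod.ext ?_ ?_
  · rw [unpolar, polar, Complex.arg_real_mul _ (Real.exp_pos _), Circle.exp_arg]
  · rw [unpolar, norm_polar, Real.log_exp]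

theorem polar_unpolar {w : ℂ} (hw : w ≠ 0) : polar (unpolar w) = w := by
  rw [polar, unpolar, Real.exp_log (norm_pos_iff.2 hw), Circle.coe_exp,
    Complex.norm_mul_exp_arg_mul_I]

theorem polar_injective : Function.Injective polar :=
  Function.LeftInverse.injective unpolar_polar

theorem continuous_polar : Continuous polar := by
  unfold polar; fun_prop

theorem continuousAt_unpolar {w : ℂ} (hw : w ≠ 0) : ContinuousAt unpolar w := by
  refine ContinuousAt.prodMk ?_ (continuous_norm.continuousAt.log (norm_ne_zero_iff.2 hw))
  have h : Continuous Real.Angle.toCircle := Circle.exp.continuous.quotient_lift _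
  exact h.continuousAt.comp (Complex.continuousAt_arg_coe_angle hw)

open Classical in
/-- The map of the plane fixing `0` which is conjugate to `g` on the punctured plane. -/
noncomputable def planeMap (g : Circle × ℝ → Circle × ℝ) (w : ℂ) : ℂ :=
  if w = 0 then 0 else polar (g (unpolar w))

theorem planeMap_zero (g : Circle × ℝ → Circle × ℝ) : planeMap g 0 = 0 := if_pos rfl

theorem planeMap_of_ne (g : Circle × ℝ → Circle × ℝ) {w : ℂ} (hw : w ≠ 0) :
    planeMap g w = polar (g (unpolar w)) := if_neg hw

theorem planeMap_polar (g : Circle × ℝ → Circle × ℝ) (x : Circle × ℝ) :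
    planeMap g (polar x) = polar (g x) := by
  rw [planeMap_of_ne _ (polar_ne_zero x), unpolar_polar]

theorem planeMap_planeMap {f g : Circle × ℝ → Circle × ℝ} (h : ∀ x, f (g x) = x) (w : ℂ) :
    planeMap f (planeMap g w) = w := by
  rcases eq_or_ne w 0 with rfl | hw
  · rw [planeMap_zero, planeMap_zero]
  · rw [planeMap_of_ne g hw, planeMap_polar, h, polar_unpolar hw]

theorem continuous_planeMap {g : Circle × ℝ → Circle × ℝ} (hg : Continuous g)
    (hb : Tendsto g (botEnd Circle) (botEnd Circle)) : Continuous (planeMap g) := by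
  refine continuous_iff_continuousAt.2 fun w => ?_
  rcases eq_or_ne w 0 with rfl | hw
  · have h1 : Tendsto unpolar (𝓝[≠] 0) (botEnd Circle) := by
      rw [botEnd, tendsto_comap_iff]
      exact Real.tendsto_log_nhdsNE_zero.comp
        (tendsto_norm_nhdsNE_zero.mono_right (nhdsWithin_mono _ fun x hx => ne_of_gt hx))
    have h2 : Tendsto (fun w => Real.exp (g (unpolar w)).2) (𝓝[≠] 0) (𝓝 0) :=
      Real.tendsto_exp_atBot.comp (tendsto_comap.comp (hb.comp h1))
    rw [continuousAt_iff_punctured_nhds, planeMap_zero]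
    refine squeeze_zero_norm' ?_ h2
    filter_upwards [self_mem_nhdsWithin] with w hw
    rw [planeMap_of_ne g hw, norm_polar]
  · have h : planeMap g =ᶠ[𝓝 w] fun w => polar (g (unpolar w)) := by
      filter_upwards [isOpen_ne.mem_nhds hw] with v hv
      exact planeMap_of_ne g hv
    refine ContinuousAt.congr ?_ h.symm
    exact continuous_polar.continuousAt.comp (hg.continuousAt.comp (continuousAt_unpolar hw))

theorem exists_homeomorph_plane (g : Circle × ℝ ≃ₜ Circle × ℝ)
    (hb : Tendsto g (botEnd Circle) (botEnd Circle))
    (hb' : Tendsto g.symm (botEnd Circle) (botEnd Circle)) :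
    ∃ G : ℂ ≃ₜ ℂ, G 0 = 0 ∧ ∀ x, G (polar x) = polar (g x) :=
  ⟨⟨⟨planeMap g, planeMap g.symm, planeMap_planeMap g.symm_apply_apply,
    planeMap_planeMap g.apply_symm_apply⟩, continuous_planeMap g.continuous hb,
    continuous_planeMap g.symm.continuous hb'⟩, planeMap_zero g, planeMap_polar g⟩

theorem exists_homeomorph_of_plane (G : ℂ ≃ₜ ℂ) (h0 : G 0 = 0) :
    ∃ g : Circle × ℝ ≃ₜ Circle × ℝ, ∀ x, polar (g x) = G (polar x) := by
  have key : ∀ G : ℂ ≃ₜ ℂ, G 0 = 0 → ∀ x, G (polar x) ≠ 0 := fun G h0 x h =>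
    polar_ne_zero x (G.injective (h.trans h0.symm))
  have h0' : G.symm 0 = 0 := by rw [Homeomorph.symm_apply_eq, h0]
  have hc : ∀ G : ℂ ≃ₜ ℂ, G 0 = 0 → Continuous fun x => unpolar (G (polar x)) := fun G h0 =>
    continuous_iff_continuousAt.2 fun x => (continuousAt_unpolar (key G h0 x)).comp
      (f := fun x => G (polar x)) (G.continuous.comp continuous_polar).continuousAt
  refine ⟨⟨⟨fun x => unpolar (G (polar x)), fun x => unpolar (G.symm (polar x)), fun x => ?_,
    fun x => ?_⟩, hc G h0, hc G.symm h0'⟩, fun x => polar_unpolar (key G h0 x)⟩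
  · dsimp only
    rw [polar_unpolar (key G h0 x), G.symm_apply_apply, unpolar_polar]
  · dsimp only
    rw [polar_unpolar (key G.symm h0' x), G.apply_symm_apply, unpolar_polar]

theorem exists_expanding_homeomorph {r : ℝ} (hr : 0 < r) :
    ∃ (C : ℂ ≃ₜ ℂ) (R : ℝ), C 0 = 0 ∧ (∀ v, ‖v‖ < 2 → ‖C.symm v‖ < r) ∧
      ∀ v, R ≤ ‖v‖ → C v = v := by
  obtain ⟨b, hb⟩ : ∃ b, b = max 0 (Real.log 2 - Real.log r) := ⟨_, rfl⟩
  have hb0 : 0 ≤ b := hb ▸ le_max_left _ _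
  have hbr : Real.log 2 - Real.log r ≤ b := hb ▸ le_max_right _ _
  obtain ⟨u, hu⟩ := exists_homeomorph_eq
    (f := fun s => max s (min (s + b) (s / 2 + (Real.log r / 2 + b)))) (c := 0) (d := b)
    (fun s s' hs => max_lt_max hs (min_lt_min (by linarith) (by linarith))) (by fun_prop)
    (fun s => le_max_left _ _) (fun s hs => max_le (by linarith) (min_le_left _ _))
  have hum : StrictMono u := fun s s' hs => by
    rw [hu, hu]; exact max_lt_max hs (min_lt_min (by linarith) (by linarith))
  have hle : ∀ s, s ≤ u s := fun s => by rw [hu]; exact le_max_left _ _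
  have hle' : ∀ s, u s ≤ s + b := fun s => by
    rw [hu]; exact max_le (by linarith) (min_le_left _ _)
  have hur : u (Real.log r) = Real.log r + b := by
    rw [hu, min_eq_left (by linarith), max_eq_right (by linarith)]
  have hus : ∀ s, Real.log r + 2 * b ≤ s → u s = s := fun s hs => by
    rw [hu]; exact max_eq_left ((min_le_right _ _).trans (by linarith))
  obtain ⟨C, hC0, hC⟩ := exists_homeomorph_plane (vert Circle u)
    (tendsto_botEnd_botEnd.2 fun T => ⟨T - b, fun x hx => by
      rw [vert_apply]; dsimp only; linarith [hle' x.2]⟩)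
    (tendsto_botEnd_botEnd.2 fun T => ⟨T, fun x hx => by
      rw [vert_symm, vert_apply]
      have := hle (u.symm x.2)
      rw [u.apply_symm_apply] at this
      dsimp only; linarith⟩)
  refine ⟨C, Real.exp (Real.log r + 2 * b), hC0, fun v hv => ?_, fun v hv => ?_⟩
  · obtain ⟨w, rfl⟩ := C.surjective v
    rw [C.symm_apply_apply]
    rcases eq_or_ne w 0 with rfl | hw
    · simpa using hr
    · rw [← polar_unpolar hw] at hv ⊢
      rw [hC, norm_polar, vert_apply, ← Real.lt_log_iff_exp_lt two_pos] at hv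
      rw [norm_polar, ← Real.lt_log_iff_exp_lt hr, ← hum.lt_iff_lt, hur]
      dsimp only at hv
      linarith
  · have hv0 : v ≠ 0 := norm_pos_iff.1 ((Real.exp_pos _).trans_le hv)
    rw [← polar_unpolar hv0] at hv ⊢
    rw [norm_polar, Real.exp_le_exp] at hv
    rw [hC, vert_apply, hus _ hv]

/-- A homeomorphism of the annulus which preserves the ends and has a fixed open set agrees near
the upper end with a homeomorphism which is the identity near the lower end. -/
theorem exists_homeomorph_eq_above (k : Circle × ℝ ≃ₜ Circle × ℝ)
    (ht : Tendsto k (topEnd Circle) (topEnd Circle))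
    (hb : Tendsto k (botEnd Circle) (botEnd Circle))
    (hb' : Tendsto k.symm (botEnd Circle) (botEnd Circle))
    (hk : ∀ᶠ x in 𝓝 (1, 0), k x = x) :
    ∃ g : Circle × ℝ ≃ₜ Circle × ℝ, (∀ x, x.2 ≤ -1 → g x = x) ∧
      ∃ d : ℝ, ∀ x, d ≤ x.2 → g x = k x := by
  obtain ⟨K, hK0, hK⟩ := exists_homeomorph_plane k hb hb'
  have hp1 : polar (1, 0) = 1 := by simp [polar]
  have hu1 : unpolar 1 = (1, 0) := by rw [← hp1, unpolar_polar]
  have hK1 : ∀ᶠ w in 𝓝 (1 : ℂ), K w = w := by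
    have h1 := continuousAt_unpolar (one_ne_zero (α := ℂ))
    rw [ContinuousAt, hu1] at h1
    filter_upwards [h1.eventually hk, isOpen_ne.mem_nhds (one_ne_zero (α := ℂ))] with w hw hw0
    rw [← polar_unpolar hw0, hK, hw]
  obtain ⟨r, hr, hrK⟩ := Metric.eventually_nhds_iff.1 hK1
  obtain ⟨C, R, hC0, hCr, hCR⟩ := exists_expanding_homeomorph hr
  have hCR' : ∀ v, R ≤ ‖v‖ → C.symm v = v := fun v hv => by
    rw [Homeomorph.symm_apply_eq, hCR v hv]
  let D : ℂ ≃ₜ ℂ := (Homeomorph.addRight (-1)).trans (C.trans (Homeomorph.addRight 1))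
  have hD : ∀ w, D w = C (w + -1) + 1 := fun w => rfl
  have hD' : ∀ w, D.symm w = C.symm (w - 1) + 1 := fun w => by
    rw [Homeomorph.symm_apply_eq, hD]; simp
  have hG : ∀ w, ‖w‖ < 1 → D (K (D.symm w)) = w := fun w hw => by
    rw [hrK, D.apply_symm_apply]
    rw [hD', dist_eq_norm, add_sub_cancel_right]
    refine hCr _ ((norm_sub_le _ _).trans_lt ?_)
    rw [norm_one]; linarith
  obtain ⟨g, hg⟩ := exists_homeomorph_of_plane (D.symm.trans (K.trans D)) (hG 0 (by simp))
  have hlarge : ∀ x : Circle × ℝ, R ≤ x.2 → R ≤ ‖polar x - 1‖ := fun x hx => by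
    have h1 := norm_sub_norm_le (polar x) 1
    rw [norm_polar, norm_one] at h1
    linarith [Real.add_one_le_exp x.2]
  obtain ⟨R', hR'⟩ := tendsto_topEnd_topEnd.1 ht R
  refine ⟨g, fun x hx => polar_injective ?_, max R R', fun x hx => polar_injective ?_⟩
  · rw [hg]
    refine hG _ ?_
    rw [norm_polar, Real.exp_lt_one_iff]
    linarith
  · rw [hg]
    change D (K (D.symm (polar x))) = _
    rw [hD', hCR' _ (hlarge x ((le_max_left _ _).trans hx)), sub_add_cancel, hK, hD,
      ← sub_eq_add_neg, hCR _ (hlarge _ (hR' x ((le_max_right _ _).trans hx))), sub_add_cancel]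

theorem annulusCover_add (p q : ℝ × ℝ) :
    annulusCover (p + q) = annulusShift (Circle.exp q.1) q.2 (annulusCover p) :=
  Prod.ext ((Circle.exp_add _ _).trans (mul_comm _ _)) rfl

theorem eventually_nhds_one_of_annulusCover {P : Circle × ℝ → Prop}
    (h : ∀ᶠ p in 𝓝 0, P (annulusCover p)) : ∀ᶠ x in 𝓝 (1, 0), P x := by
  have hc : Tendsto (fun x : Circle × ℝ => ((x.1 : ℂ).arg, x.2)) (𝓝 (1, 0)) (𝓝 0) := by
    have h1 : ContinuousAt (fun x : Circle × ℝ => ((x.1 : ℂ).arg, x.2)) (1, 0) :=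
      ((Complex.continuousAt_arg (by simp)).comp (f := fun x : Circle × ℝ => (x.1 : ℂ))
        (by fun_prop)).prodMk continuousAt_snd
    simpa [ContinuousAt, Prod.zero_eq_mk] using h1
  filter_upwards [hc.eventually h] with x hx
  rwa [annulusCover_arg] at hx

/-- After composition with shifts, a homeomorphism in the commutator subgroup agrees on an open set
with a homeomorphism of compact support. -/
theorem exists_compactly_supported_eventuallyEq {h : Circle × ℝ ≃ₜ Circle × ℝ}
    (hh : h ∈ commutator (Circle × ℝ ≃ₜ Circle × ℝ)) :
    ∃ (f : Circle × ℝ ≃ₜ Circle × ℝ) (z w : Circle) (a b : ℝ), (∀ x, 2 ≤ |x.2| → f x = x) ∧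
      ∀ᶠ x in 𝓝 (1, 0), f x = annulusShift z a (h (annulusShift w b x)) := by
  obtain ⟨ht, -⟩ := tendsto_ends_of_mem_commutator hh
  obtain ⟨ht', hb'⟩ := tendsto_ends_of_mem_commutator (inv_mem hh)
  obtain ⟨H, hH, hHp⟩ := exists_homeomorph_lift hh
  have hH2 : ∀ p, (H p).2 = (h (annulusCover p)).2 := fun p => congrArg Prod.snd (hH p)
  have hH2' : ∀ p, (H.symm p).2 = (h⁻¹ (annulusCover p)).2 := fun p => by
    obtain ⟨q, rfl⟩ := H.surjective p
    change _ = (h.symm _).2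
    rw [H.symm_apply_apply, hH, h.symm_apply_apply]
    rfl
  rw [tendsto_topEnd_topEnd] at ht ht'
  rw [tendsto_botEnd_botEnd] at hb'
  obtain ⟨k, T, hT, hkH, hkT, hkσ⟩ := exists_periodic H
    (tendsto_topEnd_topEnd.2 fun T => (ht T).imp fun R hR x hx => by rw [hH2]; exact hR _ hx)
    (tendsto_topEnd_topEnd.2 fun T => (ht' T).imp fun R hR x hx => by rw [hH2']; exact hR _ hx)
    (tendsto_botEnd_botEnd.2 fun T => (hb' T).imp fun R hR x hx => by rw [hH2']; exact hR _ hx)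
  have hmap : ∀ x : ℝ × ℝ, Prod.map (· + 2 * Real.pi) id x = x + (2 * Real.pi, 0) := fun x =>
    Prod.ext rfl (add_zero _).symm
  have hvert : ∀ x : ℝ × ℝ, vertTranslation ℝ T x = x + (0, T) := fun x =>
    Prod.ext (add_zero _).symm rfl
  obtain ⟨M, hM⟩ := exists_bounded_of_periodic k Real.two_pi_pos hT
    (fun x => by
      rw [← hmap, ← hmap]
      exact hkσ _ (fun x => by rw [hmap, hmap, hHp]) x)
    (fun x => by rw [← hvert, ← hvert]; exact hkT x)
  obtain ⟨p, hp⟩ : ∃ p : ℝ × ℝ, p = (0, 5 / 4) := ⟨_, rfl⟩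
  obtain ⟨F, hF, hFk⟩ := exists_homeomorph_eventuallyEq
    ((Homeomorph.addRight p).trans (k.trans (Homeomorph.addRight (-k p))))
    (M := M + ‖p‖ + ‖k p‖) (fun x => by
      change ‖k (x + p) + -k p - x‖ ≤ _
      have e : k (x + p) + -k p - x = k (x + p) - (x + p) + p - k p := by abel
      rw [e]
      refine (norm_sub_le _ _).trans (add_le_add_left ((norm_add_le _ _).trans ?_) _)
      exact add_le_add_left (hM _) _)
    (by change k (0 + p) + -k p = 0; simp)
  obtain ⟨f, hf, hfF⟩ := exists_homeomorph_annulus F hF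
  refine ⟨f, Circle.exp (-k p).1, Circle.exp p.1, (-k p).2, p.2, hf,
    eventually_nhds_one_of_annulusCover ?_⟩
  have hnear : ∀ᶠ q : ℝ × ℝ in 𝓝 0, 1 < (q + p).2 ∧ (q + p).2 < 3 / 2 := by
    have hc : ContinuousAt (fun q : ℝ × ℝ => (q + p).2) 0 := by fun_prop
    exact (hc.eventually_const_lt (by rw [hp]; norm_num)).and
      (hc.eventually_lt_const (by rw [hp]; norm_num))
  filter_upwards [hfF, hFk, hnear] with q hq1 hq2 hq3
  rw [hq1, hq2]
  change annulusCover (k (q + p) + -k p) = _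
  rw [hkH _ hq3.1 hq3.2, annulusCover_add, hH, annulusCover_add q]

theorem tendsto_ends_annulusShift (w : Circle) (c : ℝ) :
    Tendsto (annulusShift w c) (topEnd Circle) (topEnd Circle) ∧
      Tendsto (annulusShift w c) (botEnd Circle) (botEnd Circle) :=
  ⟨tendsto_topEnd_topEnd.2 fun T => ⟨T - c, fun x hx => by
      rw [annulusShift_apply]; dsimp only; linarith⟩,
    tendsto_botEnd_botEnd.2 fun T => ⟨T - c, fun x hx => by
      rw [annulusShift_apply]; dsimp only; linarith⟩⟩

theorem tendsto_ends_of_eq_self {f : Circle × ℝ → Circle × ℝ} {c : ℝ}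
    (hf : ∀ x, c ≤ |x.2| → f x = x) :
    Tendsto f (topEnd Circle) (topEnd Circle) ∧ Tendsto f (botEnd Circle) (botEnd Circle) :=
  ⟨tendsto_topEnd_topEnd.2 fun T => ⟨max T c, fun x hx => by
      rw [hf x ((le_max_right _ _).trans (hx.trans (le_abs_self _)))]
      exact (le_max_left _ _).trans hx⟩,
    tendsto_botEnd_botEnd.2 fun T => ⟨min T (-c), fun x hx => by
      rw [hf x ((le_neg.1 (hx.trans (min_le_right _ _))).trans (neg_le_abs _))]
      exact hx.trans (min_le_left _ _)⟩⟩

theorem isConjProd_of_eventually_eq_self {k : Circle × ℝ ≃ₜ Circle × ℝ}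
    {f : Circle × ℝ ≃ₜ Circle × ℝ} {c : ℝ} (hf : ∀ x, c ≤ |x.2| → f x = x)
    (ht : Tendsto k (topEnd Circle) (topEnd Circle))
    (hb : Tendsto k (botEnd Circle) (botEnd Circle))
    (ht' : Tendsto k.symm (topEnd Circle) (topEnd Circle))
    (hb' : Tendsto k.symm (botEnd Circle) (botEnd Circle))
    (hk : ∀ᶠ x in 𝓝 (1, 0), k x = x) : IsConjProd annulusFlip 8 (f * k) := by
  obtain ⟨g, hg, d, hgk⟩ := exists_homeomorph_eq_above k ht hb hb' hk
  obtain ⟨R, hR⟩ := tendsto_topEnd_topEnd.1 ht' d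
  have e : f * k = f * k * g⁻¹ * g := by simp
  rw [e]
  refine IsConjProd.mul (m := 4) (n := 4)
    (isConjProd_of_eq_self_above (c := max R c) fun x hx => ?_) (isConjProd_of_eq_self_below hg)
  change f (k (g.symm x)) = x
  have hgx : g.symm x = k.symm x := by
    rw [Homeomorph.symm_apply_eq, hgk _ (hR x ((le_max_left _ _).trans hx)), k.apply_symm_apply]
  rw [hgx, k.apply_symm_apply, hf x ((le_max_right _ _).trans (hx.trans (le_abs_self _)))]

theorem isConjProd_of_mem_commutator {h : Circle × ℝ ≃ₜ Circle × ℝ}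
    (hh : h ∈ commutator (Circle × ℝ ≃ₜ Circle × ℝ)) : IsConjProd annulusFlip 10 h := by
  obtain ⟨f, z, w, a, b, hf, hfh⟩ := exists_compactly_supported_eventuallyEq hh
  have hf' : ∀ x, 2 ≤ |x.2| → f.symm x = x := fun x hx => by
    rw [Homeomorph.symm_apply_eq, hf x hx]
  obtain ⟨ht, hb⟩ := tendsto_ends_of_mem_commutator hh
  obtain ⟨ht', hb'⟩ := tendsto_ends_of_mem_commutator (inv_mem hh)
  obtain ⟨hft, hfb⟩ := tendsto_ends_of_eq_self hf
  obtain ⟨hft', hfb'⟩ := tendsto_ends_of_eq_self hf'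
  obtain ⟨hzt, hzb⟩ := tendsto_ends_annulusShift z a
  obtain ⟨hwt, hwb⟩ := tendsto_ends_annulusShift w b
  obtain ⟨hzt', hzb'⟩ := tendsto_ends_annulusShift z⁻¹ (-a)
  obtain ⟨hwt', hwb'⟩ := tendsto_ends_annulusShift w⁻¹ (-b)
  rw [← annulusShift_inv] at hzt' hzb' hwt' hwb'
  have key : IsConjProd annulusFlip 8
      (f * (f⁻¹ * (annulusShift z a * h * annulusShift w b))) :=
    isConjProd_of_eventually_eq_self hf
      (hft'.comp (hzt.comp (ht.comp hwt))) (hfb'.comp (hzb.comp (hb.comp hwb)))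
      (hwt'.comp (ht'.comp (hzt'.comp hft))) (hwb'.comp (hb'.comp (hzb'.comp hfb))) (by
        filter_upwards [hfh] with x hx
        change f.symm (annulusShift z a (h (annulusShift w b x))) = x
        rw [← hx, f.symm_apply_apply])
  rw [mul_inv_cancel_left] at key
  have e : h = (annulusShift z a)⁻¹ * (annulusShift w b)⁻¹ * (annulusShift w b *
      (annulusShift z a * h * annulusShift w b) * (annulusShift w b)⁻¹) := by
    group
  rw [e, annulusShift_inv, annulusShift_inv, annulusShift_mul, ← annulusShift_inv w]
  exact (isConjProd_annulusShift _ _).mul (key.conj _)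

/-- There is an involution `θ` of the open annulus `S¹ × ℝ` such that every element
of the commutator subgroup of `Homeo(S¹ × ℝ)` is a product of at most `17`
conjugates of `θ`. -/
theorem homeo_annulus_involution_normal_generator :
    ∃ θ : (Circle × ℝ) ≃ₜ (Circle × ℝ), θ ^ 2 = 1 ∧
      ∀ h ∈ commutator ((Circle × ℝ) ≃ₜ (Circle × ℝ)),
        ∃ L : List ((Circle × ℝ) ≃ₜ (Circle × ℝ)),
          L.length ≤ 17 ∧
          (∀ x ∈ L, ∃ g : (Circle × ℝ) ≃ₜ (Circle × ℝ), x = g * θ * g⁻¹) ∧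
          h = L.prod := by
  refine ⟨annulusFlip, annulusFlip_sq, fun h hh => ?_⟩
  obtain ⟨L, hL, hθ, hprod⟩ := isConjProd_of_mem_commutator hh
  exact ⟨L, by omega, hθ, hprod⟩
end

section
/- Let X be a topological space and let h, σ be self-homeomorphisms of X. Suppose the family (σ^{2n}(supp(h)))_{n≥0} is locally finite and pairwise disjoint. Then there exists a self-homeomorphism φ of X such that h = (φ ∘ σ ∘ φ⁻¹) ∘ (φ ∘ σ ∘ φ⁻¹) ∘ σ⁻¹ ∘ σ⁻¹; in particular, h is a product of four elements of Homeo(X), each of which is a conjugate of σ or of σ⁻¹. -/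
open Pointwise

/-- The support of a self-homeomorphism: the closure of the set of non-fixed points. -/
def homeoSupp {X : Type*} [TopologicalSpace X] (f : X ≃ₜ X) : Set X :=
  closure {x | f x ≠ x}

theorem Homeomorph.apply_mem_of_forall_notMem_eq {X : Type*} [TopologicalSpace X]
    {f : X ≃ₜ X} {S : Set X} (hf : ∀ x, x ∉ S → f x = x) {x : X} (hx : x ∈ S) : f x ∈ S := by
  by_contra hn
  exact hn ((f.injective (hf _ hn)).symm ▸ hx)

theorem Homeomorph.symm_apply_eq_of_forall_notMem_eq {X : Type*} [TopologicalSpace X]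
    {f : X ≃ₜ X} {S : Set X} (hf : ∀ x, x ∉ S → f x = x) (x : X) (hx : x ∉ S) :
    f.symm x = x := by
  rw [f.symm_apply_eq, hf x hx]

/-- A homeomorphism supported in `S` moves no point into a set disjoint from `S`. -/
theorem Homeomorph.apply_notMem_of_disjoint {X : Type*} [TopologicalSpace X]
    {f : X ≃ₜ X} {S T : Set X} (hf : ∀ x, x ∉ S → f x = x) (hST : Disjoint S T) {x : X}
    (hx : x ∉ T) : f x ∉ T := by
  by_cases hxS : x ∈ S
  · exact Set.disjoint_left.1 hST (Homeomorph.apply_mem_of_forall_notMem_eq hf hxS)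
  · rwa [hf x hxS]

theorem Set.exists_forall_ne_notMem_of_pairwise_disjoint {X ι : Type*} [Nonempty ι]
    {S : ι → Set X} (hS : Pairwise fun i j => Disjoint (S i) (S j)) (x : X) :
    ∃ i, ∀ j, j ≠ i → x ∉ S j := by
  by_cases hx : ∃ i, x ∈ S i
  · obtain ⟨i, hi⟩ := hx
    exact ⟨i, fun j hj => Set.disjoint_left.1 (hS hj.symm) hi⟩
  · push Not at hx
    exact ⟨Classical.arbitrary ι, fun j _ => hx j⟩

open Classical in
/-- The map that agrees with `f i` on `S i` and is the identity elsewhere. -/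
noncomputable def disjointGlue {X ι : Type*} (S : ι → Set X) (f : ι → X → X) (x : X) : X :=
  if hx : ∃ i, x ∈ S i then f hx.choose x else x

theorem disjointGlue_apply {X ι : Type*} {S : ι → Set X} {f : ι → X → X}
    (hf : ∀ i x, x ∉ S i → f i x = x) {i : ι} {x : X} (hx : ∀ j, j ≠ i → x ∉ S j) :
    disjointGlue S f x = f i x := by
  unfold disjointGlue
  split_ifs with hex
  · have : hex.choose = i := by
      by_contra hne
      exact hx _ hne hex.choose_spec
    rw [this]
  · exact (hf i x fun hi => hex ⟨i, hi⟩).symm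

theorem continuous_disjointGlue {X ι : Type*} [TopologicalSpace X] [Nonempty ι]
    {S : ι → Set X} {f : ι → X → X} (hc : ∀ i, IsClosed (S i)) (hlf : LocallyFinite S)
    (hS : Pairwise fun i j => Disjoint (S i) (S j)) (hf : ∀ i x, x ∉ S i → f i x = x)
    (hfc : ∀ i, Continuous (f i)) : Continuous (disjointGlue S f) := by
  rw [continuous_iff_continuousAt]
  intro x
  obtain ⟨i, hi⟩ := Set.exists_forall_ne_notMem_of_pairwise_disjoint hS x
  have hclosed : IsClosed (⋃ j : {j // j ≠ i}, S j) :=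
    (hlf.comp_injective Subtype.val_injective).isClosed_iUnion fun j => hc j
  refine (hfc i).continuousAt.congr ?_
  filter_upwards [hclosed.isOpen_compl.mem_nhds
    (by simpa using hi : x ∈ (⋃ j : {j // j ≠ i}, S j)ᶜ)] with y hy
  exact (disjointGlue_apply hf (by simpa using hy)).symm

theorem disjointGlue_symm_disjointGlue {X ι : Type*} [TopologicalSpace X] [Nonempty ι]
    {S : ι → Set X} {f : ι → X ≃ₜ X} (hS : Pairwise fun i j => Disjoint (S i) (S j))
    (hf : ∀ i x, x ∉ S i → f i x = x) (x : X) :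
    disjointGlue S (fun i => (f i).symm) (disjointGlue S (fun i => f i) x) = x := by
  obtain ⟨i, hi⟩ := Set.exists_forall_ne_notMem_of_pairwise_disjoint hS x
  rw [disjointGlue_apply hf hi,
    disjointGlue_apply (fun i => Homeomorph.symm_apply_eq_of_forall_notMem_eq (hf i))
      fun j hj => Homeomorph.apply_notMem_of_disjoint (hf i) (hS hj.symm) (hi j hj),
    Homeomorph.symm_apply_apply]

/-- The product of homeomorphisms supported in the members of a locally finite, pairwise
disjoint family of closed sets. -/
noncomputable def Homeomorph.disjointProd {X ι : Type*} [TopologicalSpace X] [Nonempty ι]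
    (S : ι → Set X) (f : ι → X ≃ₜ X) (hc : ∀ i, IsClosed (S i)) (hlf : LocallyFinite S)
    (hS : Pairwise fun i j => Disjoint (S i) (S j)) (hf : ∀ i x, x ∉ S i → f i x = x) :
    X ≃ₜ X where
  toFun := disjointGlue S fun i => f i
  invFun := disjointGlue S fun i => (f i).symm
  left_inv := disjointGlue_symm_disjointGlue hS hf
  right_inv := disjointGlue_symm_disjointGlue (f := fun i => (f i).symm) hS
    fun i => Homeomorph.symm_apply_eq_of_forall_notMem_eq (hf i)
  continuous_toFun := continuous_disjointGlue hc hlf hS hf fun i => (f i).continuous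
  continuous_invFun := continuous_disjointGlue hc hlf hS
    (fun i => Homeomorph.symm_apply_eq_of_forall_notMem_eq (hf i)) fun i => (f i).symm.continuous

theorem apply_eq_of_notMem_homeoSupp {X : Type*} [TopologicalSpace X] {h : X ≃ₜ X} {x : X}
    (hx : x ∉ homeoSupp h) : h x = x := by
  by_contra hne
  exact hx (subset_closure hne)

theorem conj_apply_eq_of_notMem_image_homeoSupp {X : Type*} [TopologicalSpace X]
    {h g : X ≃ₜ X} {x : X} (hx : x ∉ g '' homeoSupp h) : (g * h * g⁻¹) x = x := by
  change g (h (g.symm x)) = x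
  have hs : g.symm x ∉ homeoSupp h := fun hs => hx ⟨_, hs, g.apply_symm_apply x⟩
  rw [apply_eq_of_notMem_homeoSupp hs, g.apply_symm_apply]


/-- If the images of the support of `h` under the even iterates of `σ` form a locally
finite, pairwise disjoint family, then `h = (φσφ⁻¹)(φσφ⁻¹)σ⁻¹σ⁻¹` for some
homeomorphism `φ`; in particular `h` is a product of four conjugates of `σ` and `σ⁻¹`. -/
theorem eq_prod_four_conjugates_of_locallyFinite_disjoint_even_iterates
    {X : Type*} [TopologicalSpace X] (h σ : X ≃ₜ X)
    (hlf : LocallyFinite fun n : ℕ => ⇑(σ ^ (2 * n)) '' homeoSupp h)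
    (hdisj : Pairwise fun m n : ℕ =>
      Disjoint (⇑(σ ^ (2 * m)) '' homeoSupp h) (⇑(σ ^ (2 * n)) '' homeoSupp h)) :
    ∃ φ : X ≃ₜ X, h = (φ * σ * φ⁻¹) * (φ * σ * φ⁻¹) * σ⁻¹ * σ⁻¹ := by
  set S : ℕ → Set X := fun n => ⇑(σ ^ (2 * n)) '' homeoSupp h with hSdef
  set f : ℕ → X ≃ₜ X := fun n => σ ^ (2 * n) * h * (σ ^ (2 * n))⁻¹ with hfdef
  have hf : ∀ n x, x ∉ S n → f n x = x := fun n x hx =>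
    conj_apply_eq_of_notMem_image_homeoSupp hx
  have hc : ∀ n, IsClosed (S n) := fun n =>
    (σ ^ (2 * n)).isClosedMap _ isClosed_closure
  have hf0 : f 0 = h := by simp [hfdef]
  have hfsucc : ∀ n, f (n + 1) = σ ^ 2 * f n * (σ ^ 2)⁻¹ := fun n => by
    simp only [hfdef, mul_add, mul_one, add_comm (2 * n) 2, pow_add, mul_inv_rev, mul_assoc]
  have hSsucc : ∀ n x, x ∈ S (n + 1) ↔ (σ ^ 2).symm x ∈ S n := fun n x => by
    have : S (n + 1) = ⇑(σ ^ 2) '' S n := by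
      simp only [hSdef, mul_add, mul_one, add_comm (2 * n) 2, pow_add, Set.image_image]
      rfl
    rw [this, Homeomorph.image_eq_preimage_symm, Set.mem_preimage]
  let φ := Homeomorph.disjointProd S f hc hlf hdisj hf
  have hφ : ∀ n x, (∀ m, m ≠ n → x ∉ S m) → φ x = f n x := fun n x hx =>
    disjointGlue_apply hf hx
  have key : φ = h * (σ ^ 2 * φ * (σ ^ 2)⁻¹) := by
    ext x
    obtain ⟨n, hn⟩ := Set.exists_forall_ne_notMem_of_pairwise_disjoint hdisj ((σ ^ 2).symm x)
    have hconj : (σ ^ 2 * φ * (σ ^ 2)⁻¹) x = f (n + 1) x := by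
      rw [hfsucc]
      exact congrArg (⇑(σ ^ 2)) (hφ n _ hn)
    change φ x = h ((σ ^ 2 * φ * (σ ^ 2)⁻¹) x)
    rw [hconj, ← hf0]
    by_cases hx : x ∈ S 0
    · have hne : ∀ m, m ≠ 0 → x ∉ S m := fun m hm => Set.disjoint_left.1 (hdisj hm.symm) hx
      rw [hf (n + 1) x (hne _ n.succ_ne_zero), hφ 0 x hne]
    · rw [hf 0 _ (Homeomorph.apply_notMem_of_disjoint (hf (n + 1)) (hdisj n.succ_ne_zero) hx)]
      refine hφ (n + 1) x fun m hm => ?_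
      cases m with
      | zero => exact hx
      | succ m => exact fun hxm => hn m (by omega) ((hSsucc m x).1 hxm)
  refine ⟨φ, ?_⟩
  rw [← mul_inv_eq_iff_eq_mul] at key
  rw [← key]
  simp only [sq, mul_inv_rev, mul_assoc, inv_inv, inv_mul_cancel_left]
end
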